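/- arXiv:2305.19104 — 4 statements merged into one kernel-verified Lean document; each statement's English description precedes it below -/
import Mathlib

section
/- Let Δ ≥ 1, h ≥ 1 and ℓ ≥ 0 be integers. If h > g(Δ), or if Δ ≥ 2, h > g(Δ−1) and ℓ > g(Δ) − h, then the persistent pebbling price of the (h,ℓ)-teabag is at least h + Δ + 1. -/
/-! ## Directed graphs and pebbling -/

structure Dgraph where
  V : Type
  [fintypeV : Fintype V]
  [decEqV : DecidableEq V]
  edge : V → V → Prop

attribute [instance] Dgraph.fintypeV Dgraph.decEqV

namespace Dgraph

/-- A directed graph is acyclic if no vertex lies on a directed cycle. -/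
def Acyclic (G : Dgraph) : Prop :=
  ∀ v : G.V, ¬ Relation.TransGen G.edge v v

def IsSink (G : Dgraph) (z : G.V) : Prop := ∀ u : G.V, ¬ G.edge z u

def IsSource (G : Dgraph) (v : G.V) : Prop := ∀ u : G.V, ¬ G.edge u v

def UniqueSink (G : Dgraph) (z : G.V) : Prop :=
  G.IsSink z ∧ ∀ w : G.V, G.IsSink w → w = z

/-- Every vertex has in-degree at most 2. -/
def InDegLe2 (G : Dgraph) : Prop :=
  ∀ v : G.V, {u : G.V | G.edge u v}.ncard ≤ 2

/-- One step of the reversible pebble game. -/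
def RevStep (G : Dgraph) (P P' : Finset G.V) : Prop :=
  (∃ v : G.V, v ∉ P ∧ (∀ u : G.V, G.edge u v → u ∈ P) ∧ P' = insert v P) ∨
  (∃ v : G.V, v ∈ P ∧ (∀ u : G.V, G.edge u v → u ∈ P) ∧ P' = P.erase v)

/-- One step of the standard pebble game. -/
def StdStep (G : Dgraph) (P P' : Finset G.V) : Prop :=
  (∃ v : G.V, v ∉ P ∧ (∀ u : G.V, G.edge u v → u ∈ P) ∧ P' = insert v P) ∨
  (∃ v : G.V, v ∈ P ∧ P' = P.erase v)

/-- An unconditional reversible pebbling of time `τ`. -/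
def IsRevPebbling (G : Dgraph) (P : ℕ → Finset G.V) (τ : ℕ) : Prop :=
  P 0 = ∅ ∧ ∀ t < τ, G.RevStep (P t) (P (t+1))

/-- An unconditional standard pebbling of time `τ`. -/
def IsStdPebbling (G : Dgraph) (P : ℕ → Finset G.V) (τ : ℕ) : Prop :=
  P 0 = ∅ ∧ ∀ t < τ, G.StdStep (P t) (P (t+1))

/-- The space of a pebbling. -/
def space (G : Dgraph) (P : ℕ → Finset G.V) (τ : ℕ) : ℕ :=
  (Finset.range (τ+1)).sup fun t => (P t).card

/-- Persistent (reversible) pebbling price of a vertex. -/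
noncomputable def pers (G : Dgraph) (v : G.V) : ℕ :=
  sInf { s : ℕ | ∃ P τ, G.IsRevPebbling P τ ∧ P τ = {v} ∧ G.space P τ = s }

/-- Visiting (reversible) pebbling price of a vertex. -/
noncomputable def visit (G : Dgraph) (v : G.V) : ℕ :=
  sInf { s : ℕ | ∃ P τ, G.IsRevPebbling P τ ∧ v ∈ P τ ∧ G.space P τ = s }

/-- Surrounding (reversible) pebbling price of a vertex. -/
noncomputable def surround (G : Dgraph) (v : G.V) : ℕ :=
  sInf { s : ℕ | ∃ P τ, G.IsRevPebbling P τ ∧ (∀ u : G.V, G.edge u v → u ∈ P τ) ∧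
    G.space P τ = s }

/-- Standard pebbling price of a vertex. -/
noncomputable def black (G : Dgraph) (z : G.V) : ℕ :=
  sInf { s : ℕ | ∃ P τ, G.IsStdPebbling P τ ∧ P τ = {z} ∧ G.space P τ = s }

/-- Space of a pebbling counted only inside the region `R`. -/
noncomputable def spaceIn (G : Dgraph) (R : Set G.V) (P : ℕ → Finset G.V) (τ : ℕ) : ℕ :=
  (Finset.range (τ+1)).sup fun t => ((P t : Set G.V) ∩ R).ncard

/-- `R`-restricted persistent price. -/
noncomputable def persIn (G : Dgraph) (R : Set G.V) (v : G.V) : ℕ :=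
  sInf { s : ℕ | ∃ P τ, G.IsRevPebbling P τ ∧ ((P τ : Set G.V) ∩ R) = {v} ∧
    G.spaceIn R P τ = s }

/-- `R`-restricted visiting price. -/
noncomputable def visitIn (G : Dgraph) (R : Set G.V) (v : G.V) : ℕ :=
  sInf { s : ℕ | ∃ P τ, G.IsRevPebbling P τ ∧ v ∈ P τ ∧ G.spaceIn R P τ = s }

/-- `R`-restricted surrounding price. -/
noncomputable def surroundIn (G : Dgraph) (R : Set G.V) (v : G.V) : ℕ :=
  sInf { s : ℕ | ∃ P τ, G.IsRevPebbling P τ ∧ (∀ u : G.V, G.edge u v → u ∈ P τ) ∧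
    G.spaceIn R P τ = s }

/-- `B` blocks the graph: every directed path from a source to a sink meets `B`. -/
def Blocks (G : Dgraph) (B : Set G.V) : Prop :=
  ∀ (p : List G.V) (hp : p ≠ []), List.Chain' G.edge p →
    G.IsSource (p.head hp) → G.IsSink (p.getLast hp) → ∃ v ∈ p, v ∈ B

/-- A minimal blocking set. -/
def MinBlocking (G : Dgraph) (B : Set G.V) : Prop :=
  G.Blocks B ∧ ∀ B' : Set G.V, B' ⊂ B → ¬ G.Blocks B'

end Dgraph

/-! ## Concrete graph families -/

/-- The function `g` with `g 1 = 0` and `g Δ = 2^(g (Δ-1) + Δ - 2) + g (Δ-1)` for `Δ ≥ 2`. -/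
def g : ℕ → ℕ
  | 0 => 0
  | 1 => 0
  | (n+2) => 2 ^ (g (n+1) + n) + g (n+1)

/-- `ginv h = min {Δ ≥ 1 | g Δ ≥ h}`. -/
noncomputable def ginv (h : ℕ) : ℕ := sInf { Δ : ℕ | 1 ≤ Δ ∧ h ≤ g Δ }

/-- The pyramid of height `h`: vertices `(i,j)` with `i ≤ j ≤ h`, vertex `(i,j)` is
at level `i`, with edges `(i,j) → (i+1,j)` and `(i,j) → (i+1,j+1)` (when the target
is a vertex). -/
def pyramid (h : ℕ) : Dgraph where
  V := {p : Fin (h+1) × Fin (h+1) // (p.1 : ℕ) ≤ (p.2 : ℕ)}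
  edge u v := (v.1.1 : ℕ) = (u.1.1 : ℕ) + 1 ∧
    ((v.1.2 : ℕ) = (u.1.2 : ℕ) ∨ (v.1.2 : ℕ) = (u.1.2 : ℕ) + 1)

/-- The sink `(h,h)` of the pyramid of height `h`. -/
def pyramidSink (h : ℕ) : (pyramid h).V := ⟨(Fin.last h, Fin.last h), le_refl _⟩

/-- The complete binary tree of height `h`, with edges directed towards the root:
the vertex `⟨k, j⟩` is the `j`-th node at depth `k`, and its parent is `⟨k-1, j/2⟩`. -/
def bintree (h : ℕ) : Dgraph where
  V := Σ k : Fin (h+1), Fin (2 ^ (k : ℕ))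
  edge u v := (u.1 : ℕ) = (v.1 : ℕ) + 1 ∧ (u.2 : ℕ) / 2 = (v.2 : ℕ)

/-- The root (unique sink) of the complete binary tree. -/
def bintreeRoot (h : ℕ) : (bintree h).V := ⟨0, ⟨0, by positivity⟩⟩

/-- The chain of width `w` and length `ℓ`: layers `0,…,ℓ` of `w` vertices each, where the
`j`-th vertex of layer `i ≥ 1` has incoming edges from the `j`-th and `(j+1 mod w)`-th
vertices of layer `i-1`. -/
def chainDag (w ℓ : ℕ) : Dgraph where
  V := Fin (ℓ+1) × Fin w
  edge u v := (v.1 : ℕ) = (u.1 : ℕ) + 1 ∧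
    ((u.2 : ℕ) = (v.2 : ℕ) ∨ (u.2 : ℕ) = ((v.2 : ℕ) + 1) % w)

/-- The road of width `w` and length `ℓ`: a chain of width `w` and length `ℓ-w+1`
(layers `0,…,ℓ-w+1`) followed by a pyramid of height `w-1` whose sources are the vertices
of layer `ℓ-w+1`; layer `i` consists of the vertices `(i,j)` with `i + j ≤ ℓ`, `j < w`. -/
def road (w ℓ : ℕ) : Dgraph where
  V := {p : Fin (ℓ+1) × Fin w // (p.1 : ℕ) + (p.2 : ℕ) ≤ ℓ}
  edge u v := (v.1.1 : ℕ) = (u.1.1 : ℕ) + 1 ∧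
    ((u.1.2 : ℕ) = (v.1.2 : ℕ) ∨ (u.1.2 : ℕ) = ((v.1.2 : ℕ) + 1) % w)

/-- The sink of the road: the single vertex on the last layer. -/
def roadSink (w ℓ : ℕ) (hw : 0 < w) : (road w ℓ).V :=
  ⟨(Fin.last ℓ, ⟨0, hw⟩), by simp⟩

/-- The directed path of length `h`: vertices `0,…,h` and edges `i → i+1`. -/
def pathDag (h : ℕ) : Dgraph where
  V := Fin (h+1)
  edge u v := (v : ℕ) = (u : ℕ) + 1

/-- The sink of the directed path. -/
def pathSink (h : ℕ) : (pathDag h).V := Fin.last h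

/-- The `(h,ℓ)`-teabag: the pyramid of height `h` with a directed path of length `ℓ`
appended to its sink.  Layer `t ≤ h` consists of the pyramid vertices `(t,j)`, `t ≤ j ≤ h`,
and layer `t > h` consists of the single path vertex `(t,h)`. -/
def teabag (h ℓ : ℕ) : Dgraph where
  V := {p : Fin (h+ℓ+1) × Fin (h+1) //
          ((p.1 : ℕ) ≤ h → (p.1 : ℕ) ≤ (p.2 : ℕ)) ∧ (h ≤ (p.1 : ℕ) → (p.2 : ℕ) = h)}
  edge u v := (v.1.1 : ℕ) = (u.1.1 : ℕ) + 1 ∧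
    ((v.1.2 : ℕ) = (u.1.2 : ℕ) ∨ (v.1.2 : ℕ) = (u.1.2 : ℕ) + 1)

/-- The sink of the `(h,ℓ)`-teabag: the final path vertex. -/
def teabagSink (h ℓ : ℕ) : (teabag h ℓ).V :=
  ⟨(Fin.last (h+ℓ), Fin.last h), by refine ⟨fun hh => ?_, fun _ => ?_⟩ <;> simp_all⟩

/-- The molding `mold G` of a graph `G`: vertices `s` (= `none`), `v^in` (= `some (v,false)`)
and `v^out` (= `some (v,true)`) for `v ∈ V(G)`, with edges `v^in → v^out`,
`u^out → v^in` for every edge `(u,v)` of `G`, and `s → v^out` for every `v`. -/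
def mold (G : Dgraph) : Dgraph where
  V := Option (G.V × Bool)
  edge u v :=
    match u, v with
    | none, some (_, true) => True
    | some (a, false), some (b, true) => a = b
    | some (a, true), some (b, false) => G.edge a b
    | _, _ => False

/-- The special source `s` of `mold G`. -/
def moldSrc (G : Dgraph) : (mold G).V := none

/-- The vertex `v^out` of `mold G`. -/
def moldOut (G : Dgraph) (v : G.V) : (mold G).V := some (v, true)

namespace TB

def StepG {V : Type} (E : V → V → Prop) (P P' : Finset V) : Prop :=
  (∀ v, (v ∈ P ↔ v ∉ P') → ∀ u, E u v → u ∈ P ∧ u ∈ P') ∧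
  (∀ v w, (v ∈ P ↔ v ∉ P') → (w ∈ P ↔ w ∉ P') → v = w)

def SeqG {V : Type} (E : V → V → Prop) (P : ℕ → Finset V) (T : ℕ) : Prop :=
  ∀ t < T, StepG E (P t) (P (t+1))

lemma StepG.symm {V : Type} {E : V → V → Prop} {P P' : Finset V} (h : StepG E P P') :
    StepG E P' P := by
  refine ⟨fun v hv u hu => ?_, fun v w hv hw => h.2 v w (by tauto) (by tauto)⟩
  exact (h.1 v (by tauto) u hu).symm

lemma SeqG.shift {V : Type} {E : V → V → Prop} {P : ℕ → Finset V} {T : ℕ}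
    (hs : SeqG E P T) (a : ℕ) : SeqG E (fun i => P (a + i)) (T - a) := by
  intro t ht
  exact hs (a + t) (by omega)

lemma SeqG.rev {V : Type} {E : V → V → Prop} {P : ℕ → Finset V} {T : ℕ}
    (hs : SeqG E P T) (b : ℕ) (hb : b ≤ T) (n : ℕ) (hn : n ≤ b) :
    SeqG E (fun i => P (b - i)) n := by
  intro t ht
  have := (hs (b - (t + 1)) (by omega)).symm
  rwa [show b - (t+1) + 1 = b - t by omega] at this

lemma StepG.filter {V : Type} {E : V → V → Prop} {P P' : Finset V} (h : StepG E P P')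
    (p : V → Prop) [DecidablePred p] (hp : ∀ u v, E u v → p v → p u) :
    StepG E (P.filter p) (P'.filter p) := by
  have key : ∀ v, (v ∈ P.filter p ↔ v ∉ P'.filter p) → p v ∧ (v ∈ P ↔ v ∉ P') := by
    intro v hv
    simp only [Finset.mem_filter] at hv
    tauto
  refine ⟨fun v hv u hu => ?_, fun v w hv hw => h.2 v w (key v hv).2 (key w hw).2⟩
  have h1 := key v hv
  have h2 := h.1 v h1.2 u hu
  simp only [Finset.mem_filter]
  exact ⟨⟨h2.1, hp u v hu h1.1⟩, ⟨h2.2, hp u v hu h1.1⟩⟩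

lemma StepG.preimage {V W : Type} {E : V → V → Prop} {E' : W → W → Prop} {P P' : Finset V}
    (h : StepG E P P') (φ : W → V) (hφ : Function.Injective φ)
    (hE : ∀ u v, E' u v → E (φ u) (φ v)) :
    StepG E' (P.preimage φ hφ.injOn) (P'.preimage φ hφ.injOn) := by
  refine ⟨fun v hv u hu => ?_, fun v w hv hw => ?_⟩
  · simp only [Finset.mem_preimage] at *
    exact h.1 _ hv _ (hE u v hu)
  · simp only [Finset.mem_preimage] at *
    exact hφ (h.2 _ _ hv hw)

/-- Generic lemma saying that the lower part stays alive. -/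
lemma alive {V : Type} {E : V → V → Prop} (U : V → Prop) [DecidablePred U]
    (hU : ∀ u v, E u v → ¬ U v → ¬ U u)
    (low surr : Finset V → Prop) (s : ℕ)
    (IH : ∀ (Q : ℕ → Finset V) (T : ℕ), SeqG E Q T → (∀ t ≤ T, ∀ v ∈ Q t, ¬ U v) →
      low (Q 0) → surr (Q T) → ∃ t ≤ T, s ≤ (Q t).card)
    (hsurr : ∀ P P' : Finset V, StepG E P P' → (∀ v ∈ P, ¬ U v) → (∃ v ∈ P', U v) →
      surr (P'.filter (fun v => ¬ U v)))
    (P : ℕ → Finset V) (T : ℕ) (hs : SeqG E P T) (h0 : ∀ v ∈ P 0, ¬ U v)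
    (hc : ∀ t ≤ T, (P t).card ≤ s) :
    ∀ t ≤ T, (∃ v ∈ P t, U v) → ¬ low ((P t).filter (fun v => ¬ U v)) := by
  classical
  intro t ht hex hlow
  -- last time before t with no U
  have hmax : ∃ u < t, (∀ v ∈ P u, ¬ U v) ∧ ∀ w, u < w → w ≤ t → ∃ v ∈ P w, U v := by
    let S := (Finset.range (t+1)).filter (fun u => ∀ v ∈ P u, ¬ U v)
    have hS : S.Nonempty := ⟨0, by simp [S]; exact h0⟩
    refine ⟨S.max' hS, ?_, ?_, ?_⟩
    · have := S.max'_mem hS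
      simp only [S, Finset.mem_filter, Finset.mem_range] at this
      rcases Nat.lt_or_ge (S.max' hS) t with h | h
      · exact h
      · have e : S.max' hS = t := by
          have := this.1
          simp only [S] at *
          omega
        obtain ⟨v, hv, hv'⟩ := hex
        have h2 := this.2
        have e' : ∀ v ∈ P (S.max' hS), ¬ U v := h2
        rw [e] at e'
        exact absurd hv' (e' v hv)
    · have := S.max'_mem hS
      simp only [S, Finset.mem_filter, Finset.mem_range] at this
      exact this.2
    · intro w hw hwt
      by_contra hcon
      push Not at hcon
      have : w ∈ S := by
        simp only [S, Finset.mem_filter, Finset.mem_range]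
        exact ⟨by omega, hcon⟩
      have := S.le_max' w this
      omega
  obtain ⟨u, hut, hu, hw⟩ := hmax
  have hsu := hsurr (P u) (P (u+1)) (hs u (by omega)) hu (hw (u+1) (by omega) (by omega))
  have hseq : SeqG E (fun i => (P (t - i)).filter (fun v => ¬ U v)) (t - (u+1)) := by
    intro i hi
    exact (hs.rev t ht (t-(u+1)) (by omega) i hi).filter _ hU
  obtain ⟨i, hi, hcard⟩ := IH _ _ hseq (by simp) (by simpa using hlow) (by
    simpa [show t - (t - (u+1)) = u+1 by omega] using hsu)
  obtain ⟨v, hv, hv'⟩ := hw (t - i) (by omega) (by omega)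
  have h1 : (P (t-i)).filter (fun v => ¬ U v) ⊂ P (t-i) := by
    refine (Finset.ssubset_iff_of_subset (Finset.filter_subset _ _)).2 ⟨v, hv, by simp [hv']⟩
  have h2 := Finset.card_lt_card h1
  have h3 := hc (t-i) (by omega)
  omega

/-! ### The path -/

def PE (u v : ℕ) : Prop := v = u + 1

lemma path_bound (k : ℕ) : ∀ (S : ℕ → Finset ℕ) (T : ℕ), SeqG PE S T → S 0 = ∅ →
    (∀ t ≤ T, (S t).card ≤ k) → ∀ t ≤ T, ∀ n ∈ S t, n + 1 < 2 ^ k := by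
  induction k with
  | zero =>
    intro S T _ _ hc t ht n hn
    have := hc t ht
    have : S t = ∅ := by simpa using this
    simp [this] at hn
  | succ k ih =>
    intro S T hs h0 hc t ht n hn
    have hpos : 0 < 2 ^ k := by positivity
    have hal := alive (E := PE) (fun n => 2 ^ k ≤ n) (by intro u v huv hv; simp [PE] at *; omega)
      (fun P => P = ∅) (fun P => 2 ^ k - 1 ∈ P) (k+1)
      (by
        intro Q T' hQ _ hl hsu
        by_contra hcon
        push Not at hcon
        have := ih Q T' hQ hl (fun t ht => by have := hcon t ht; omega) T' le_rfl _ hsu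
        omega)
      (by
        rintro P P' hst hP ⟨v, hv, hUv⟩
        have hvP : v ∉ P := fun h => hP v h hUv
        have h1 := hst.1 v (by tauto) (v-1) (by simp [PE]; omega)
        have h2 := hP _ h1.1
        simp only [Finset.mem_filter]
        have : v - 1 = 2 ^ k - 1 := by omega
        rw [← this]
        exact ⟨h1.2, h2⟩)
      S T hs (by simp [h0]) hc
    have hinj : Function.Injective (fun n => n + 2 ^ k) := fun a b h => by simpa using h
    by_cases hn2 : 2 ^ k ≤ n
    · have := ih (fun t => (S t).preimage (fun n => n + 2 ^ k) hinj.injOn) T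
        (fun t ht => (hs t ht).preimage _ hinj (by intro u v h; simp [PE] at *; omega))
        (by simp [h0])
        (by
          intro t ht
          classical
          rw [Finset.card_preimage]
          by_cases hex : ∃ v ∈ S t, 2 ^ k ≤ v
          · have h1 := hal t ht hex
            obtain ⟨w, hw⟩ := Finset.nonempty_iff_ne_empty.2 h1
            simp only [Finset.mem_filter] at hw
            have h2 : (S t).filter (fun x => x ∈ Set.range (fun n => n + 2 ^ k)) ⊂ S t := by
              refine (Finset.ssubset_iff_of_subset (Finset.filter_subset _ _)).2 ⟨w, hw.1, ?_⟩
              simp only [Finset.mem_filter, Set.mem_range, not_and, not_exists]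
              intro _ x
              omega
            have h3 := Finset.card_lt_card h2
            have h4 := hc t ht
            omega
          · push Not at hex
            have : (S t).filter (fun x => x ∈ Set.range (fun n => n + 2 ^ k)) = ∅ := by
              refine Finset.filter_eq_empty_iff.2 ?_
              rintro x hx ⟨y, rfl⟩
              have := hex _ hx
              simp at this
            rw [this]; simp)
        t ht (n - 2^k) (by simp [Nat.sub_add_cancel hn2, hn])
      rw [pow_succ]; omega
    · rw [pow_succ]; omega

/-! ### The teabag model -/

abbrev W := (ℕ × ℕ) ⊕ ℕ

def TE (h : ℕ) : W → W → Prop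
  | .inl (a, b), .inl (x, y) => 1 ≤ x + y ∧ x + y < h ∧ ((a = x + 1 ∧ b = y) ∨ (a = x ∧ b = y + 1))
  | .inl (a, b), .inr n => n = 0 ∧ ((a = 1 ∧ b = 0) ∨ (a = 0 ∧ b = 1))
  | .inr m, .inr n => n = m + 1
  | .inr _, .inl _ => False

def IsPath (f : ℕ → ℕ) : Prop := f 0 = 0 ∧ ∀ d, f (d+1) = f d ∨ f (d+1) = f d + 1

lemma IsPath.le {f : ℕ → ℕ} (hf : IsPath f) (d : ℕ) : f d ≤ d := by
  induction d with
  | zero => simp [hf.1]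
  | succ d ih => rcases hf.2 d with h | h <;> omega

def Avoids (h : ℕ) (P : Finset W) (f : ℕ → ℕ) : Prop :=
  ∀ d, 1 ≤ d → d ≤ h → (Sum.inl (f d, d - f d) : W) ∉ P

def Unbl (h : ℕ) (P : Finset W) : Prop := ∃ f, IsPath f ∧ Avoids h P f

def Full (h : ℕ) (P : Finset W) : Prop := Unbl h P ∧ ∀ n, (Sum.inr n : W) ∉ P

def Surr (h ℓ : ℕ) (P : Finset W) : Prop := ∀ u, TE h u (.inr ℓ) → u ∈ P

lemma not_full_of_surr {h ℓ : ℕ} (hh : 1 ≤ h) {P : Finset W} (hs : Surr h ℓ P) : ¬ Full h P := by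
  rintro ⟨⟨f, hf, ha⟩, hr⟩
  rcases ℓ with _ | n
  · have h1 := hs (.inl (1,0)) (by simp [TE])
    have h2 := hs (.inl (0,1)) (by simp [TE])
    have h3 := ha 1 le_rfl hh
    have := hf.1
    rcases hf.2 0 with h | h <;> simp_all
  · exact hr n (hs (.inr n) (by simp [TE]))

/-- The claim proved by induction. -/
def Claim (D h ℓ : ℕ) : Prop :=
  ∀ (P : ℕ → Finset W) (T : ℕ), SeqG (TE h) P T → Full h (P 0) → Surr h ℓ (P T) →
    ∃ t ≤ T, h + D ≤ (P t).card

lemma last_full {h : ℕ} (P : ℕ → Finset W) (T : ℕ) (h0 : Full h (P 0)) (hT : ¬ Full h (P T)) :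
    ∃ u < T, Full h (P u) ∧ ∀ w, u < w → w ≤ T → ¬ Full h (P w) := by
  induction T with
  | zero => exact absurd h0 hT
  | succ T ih =>
    by_cases hF : Full h (P T)
    · refine ⟨T, by omega, hF, fun w h1 h2 => ?_⟩
      rw [show w = T + 1 by omega]; exact hT
    · obtain ⟨u, hu, h1, h2⟩ := ih hF
      refine ⟨u, by omega, h1, fun w h3 h4 => ?_⟩
      rcases Nat.lt_or_ge T w with h | h
      · rw [show w = T + 1 by omega]; exact hT
      · exact h2 w h3 h

/-- The step that blocks must place a pebble on the source of the path. -/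
lemma blocking_step {h : ℕ} (hh : 1 ≤ h) {P P' : Finset W} (hst : StepG (TE h) P P')
    {f : ℕ → ℕ} (hf : IsPath f) (ha : Avoids h P f) (hr : ∀ n, (Sum.inr n : W) ∉ P)
    (hn : ¬ Full h P') : (Sum.inl (f h, h - f h) : W) ∈ P' ∧ ∀ n, (Sum.inr n : W) ∉ P' := by
  have hr' : ∀ n, (Sum.inr n : W) ∉ P' := by
    intro n hn'
    have hc : (Sum.inr n : W) ∈ P ↔ (Sum.inr n : W) ∉ P' := by have := hr n; tauto
    rcases n with _ | n
    · have h1 := (hst.1 _ hc (.inl (1,0)) (by simp [TE])).1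
      have h2 := (hst.1 _ hc (.inl (0,1)) (by simp [TE])).1
      have h3 := ha 1 le_rfl hh
      have := hf.1
      rcases hf.2 0 with h | h <;> simp_all
    · exact hr n (hst.1 _ hc (.inr n) (by simp [TE])).1
  refine ⟨?_, hr'⟩
  by_contra hcon
  apply hn
  refine ⟨⟨f, hf, fun d h1 h2 hd => ?_⟩, hr'⟩
  have hdh : d < h := by
    rcases Nat.lt_or_ge d h with h3 | h3
    · exact h3
    · have : d = h := by omega
      subst this; exact absurd hd hcon
  have hc : (Sum.inl (f d, d - f d) : W) ∈ P ↔ (Sum.inl (f d, d - f d) : W) ∉ P' := by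
    have := ha d h1 h2; tauto
  have hle := hf.le d
  have h4 := (hst.1 _ hc (.inl (f (d+1), d + 1 - f (d+1))) (by
    simp only [TE]
    rcases hf.2 d with h | h <;> omega)).1
  exact ha (d+1) (by omega) (by omega) h4

lemma claim_one (h ℓ : ℕ) (hh : 1 ≤ h) : Claim 1 h ℓ := by
  intro P T hs h0 hT
  obtain ⟨u, hu, hF, hl⟩ := last_full P T h0 (not_full_of_surr hh hT)
  obtain ⟨⟨f, hf, ha⟩, hr⟩ := hF
  have hnf := hl (u+1) (by omega) (by omega)
  have hst := hs u hu
  obtain ⟨hsrc, hr'⟩ := blocking_step hh hst hf ha hr hnf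
  refine ⟨u+1, by omega, ?_⟩
  have hfle := hf.le
  -- f avoids P (u+1) except at h
  have hav : ∀ d, 1 ≤ d → d < h → (Sum.inl (f d, d - f d) : W) ∉ P (u+1) := by
    intro d h1 h2 hd
    have e := hst.2 _ _ (show _ ↔ _ by have := ha d h1 h2.le; tauto)
      (show (Sum.inl (f h, h - f h) : W) ∈ P u ↔ _ by have := ha h hh le_rfl; tauto)
    have h3 := hfle d
    have h4 := hfle h
    simp only [Sum.inl.injEq, Prod.mk.injEq] at e
    omega
  have hblk : ∀ F, IsPath F → ∃ d, 1 ≤ d ∧ d ≤ h ∧ (Sum.inl (F d, d - F d) : W) ∈ P (u+1) := by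
    intro F hF
    by_contra hcon
    push Not at hcon
    exact hnf ⟨⟨F, hF, hcon⟩, hr'⟩
  let ψ : W → ℕ := fun w => match w with
    | .inl (x, y) => if x < f (x+y) then x else if f (x+y) < x then h - y else f h
    | .inr _ => 0
  have : (Finset.range (h+1)).card ≤ (P (u+1)).card := by
    apply Finset.card_le_card_of_surjOn ψ
    intro c hc
    simp only [Finset.coe_range, Set.mem_Iio] at hc
    rcases lt_trichotomy c (f h) with hlt | heq | hgt
    · obtain ⟨d, h1, h2, h3⟩ := hblk (fun d => min (f d) c) ⟨by simp [hf.1], fun d => by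
        dsimp only
        rcases hf.2 d with h | h <;> omega⟩
      have hle := hfle d
      have hcd : c < f d := by
        by_contra hcon
        have e : min (f d) c = f d := by omega
        rw [e] at h3
        rcases Nat.lt_or_ge d h with h4 | h4
        · exact hav d h1 h4 h3
        · have : d = h := by omega
          subst this; omega
      refine ⟨_, h3, ?_⟩
      have e : min (f d) c = c := by omega
      simp only [ψ, e, show c + (d - c) = d by omega, hcd, if_true]
    · refine ⟨_, hsrc, ?_⟩
      have := hfle h
      simp [ψ, show f h + (h - f h) = h by omega, heq]
    · obtain ⟨d, h1, h2, h3⟩ := hblk (fun d => max (f d) (d - (h - c))) ⟨by simp [hf.1], fun d => by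
        dsimp only
        rcases hf.2 d with h | h <;> omega⟩
      have hle := hfle d
      have hcd : f d < d - (h - c) := by
        by_contra hcon
        have e : max (f d) (d - (h - c)) = f d := by omega
        rw [e] at h3
        rcases Nat.lt_or_ge d h with h4 | h4
        · exact hav d h1 h4 h3
        · have : d = h := by omega
          subst this; omega
      refine ⟨_, h3, ?_⟩
      have e : max (f d) (d - (h - c)) = d - (h - c) := by omega
      have e2 : d - (h - c) + (d - (d - (h - c))) = d := by omega
      have e3 : ¬ (d - (h - c) < f d) := by omega
      simp only [ψ, e, e2, e3, hcd, if_true, if_false]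
      omega
  simpa using this

lemma unbl_filter {h : ℕ} {P : Finset W} :
    Unbl h (P.filter (fun w => ¬ (w.isRight = true))) ↔ Unbl h P := by
  simp [Unbl, Avoids]

lemma teabag_alive {D h : ℕ} (hC : Claim D h 0) (P : ℕ → Finset W) (T : ℕ)
    (hs : SeqG (TE h) P T) (h0 : ∀ n, (Sum.inr n : W) ∉ P 0)
    (hc : ∀ t ≤ T, (P t).card ≤ h + D) :
    ∀ t ≤ T, (∃ n, (Sum.inr n : W) ∈ P t) → ¬ Unbl h (P t) := by
  intro t ht hex hun
  refine alive (E := TE h) (fun w => w.isRight = true) ?_ (Unbl h) (Surr h 0) (h + D) ?_ ?_ P T hs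
    ?_ hc t ht ?_ (unbl_filter.2 hun)
  · rintro (⟨a, b⟩ | m) (⟨x, y⟩ | n) <;> simp [TE]
  · intro Q T' hQ hno hl hsu
    refine hC Q T' hQ ⟨hl, fun n hn => ?_⟩ hsu
    exact hno 0 (by omega) _ hn (by simp)
  · rintro A B hst hA ⟨v, hv, hUv⟩
    rcases v with v | n
    · simp at hUv
    · have hc : (Sum.inr n : W) ∈ A ↔ (Sum.inr n : W) ∉ B := by
        have : (Sum.inr n : W) ∉ A := fun h => hA _ h (by simp)
        tauto
      rcases n with _ | n
      · rintro (⟨a, b⟩ | m) hu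
        · simpa using (hst.1 _ hc _ hu).2
        · simp [TE] at hu
      · have := (hst.1 _ hc (.inr n) (by simp [TE])).1
        exact absurd (by simp) (hA _ this)
  · rintro (v | n) hv
    · simp
    · exact absurd hv (h0 n)
  · obtain ⟨n, hn⟩ := hex
    exact ⟨_, hn, by simp⟩

/-! ### Base case: long path -/

lemma claim_base {D h ℓ : ℕ} (hh : 1 ≤ h) (hC : Claim D h 0) (hl : 2 ^ (h + D - 2) ≤ ℓ)
    (hD : 1 ≤ D) : Claim (D+1) h ℓ := by
  intro P T hs h0 hT
  by_contra hcon
  push Not at hcon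
  have hc : ∀ t ≤ T, (P t).card ≤ h + D := fun t ht => by have := hcon t ht; omega
  have hal := teabag_alive hC P T hs h0.2 hc
  have hinj : Function.Injective (Sum.inr : ℕ → W) := Sum.inr_injective
  have hpos : 0 < 2 ^ (h + D - 2) := by positivity
  have := path_bound (h + D - 2) (fun t => (P t).preimage Sum.inr hinj.injOn) T
    (fun t ht => (hs t ht).preimage _ hinj (by intro u v h; simpa [TE, PE] using h))
    (by ext n; simpa using h0.2 n)
    (by
      intro t ht
      by_cases hex : ∃ n, (Sum.inr n : W) ∈ P t
      · have hb := hal t ht hex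
        have hx : ∃ d, 1 ≤ d ∧ d ≤ h ∧ (Sum.inl (0, d) : W) ∈ P t := by
          by_contra hcon
          push Not at hcon
          exact hb ⟨fun _ => 0, ⟨rfl, by simp⟩, by simpa [Avoids] using hcon⟩
        have hy : ∃ d, 1 ≤ d ∧ d ≤ h ∧ (Sum.inl (d, 0) : W) ∈ P t := by
          by_contra hcon
          push Not at hcon
          exact hb ⟨fun d => d, ⟨rfl, by simp⟩, by simpa [Avoids] using hcon⟩
        obtain ⟨a, ha1, ha2, ha⟩ := hx
        obtain ⟨b, hb1, hb2, hb⟩ := hy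
        have hsub : ((P t).preimage Sum.inr hinj.injOn).map ⟨Sum.inr, hinj⟩ ∪
            {Sum.inl (0, a), Sum.inl (b, 0)} ⊆ P t := by
          intro w hw
          simp only [Finset.mem_union, Finset.mem_map, Finset.mem_preimage,
            Function.Embedding.coeFn_mk, Finset.mem_insert, Finset.mem_singleton] at hw
          rcases hw with ⟨n, hn, rfl⟩ | rfl | rfl <;> assumption
        have h1 := Finset.card_le_card hsub
        rw [Finset.card_union_of_disjoint, Finset.card_map, Finset.card_pair] at h1
        · have := hc t ht
          omega
        · simp; omega
        · rw [Finset.disjoint_left]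
          intro w hw
          simp only [Finset.mem_map, Finset.mem_preimage,
            Function.Embedding.coeFn_mk] at hw
          obtain ⟨n, hn, rfl⟩ := hw
          simp
      · push Not at hex
        have : (P t).preimage Sum.inr hinj.injOn = ∅ := by ext n; simpa using hex n
        simp [this])
    T le_rfl (ℓ - 1) (by
      simp only [Finset.mem_preimage]
      apply hT
      simp only [TE]; omega)
  omega

/-! ### Reduction -/

def emb : W → W
  | .inl (0, 0) => .inl (0, 0)
  | .inl (x, y) => .inl (x+1, y)
  | .inr 0 => .inl (1, 0)
  | .inr (n+1) => .inr n

lemma emb_inl (x y : ℕ) (h : 1 ≤ x + y) : emb (.inl (x, y)) = .inl (x+1, y) := by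
  rcases x with _ | x <;> rcases y with _ | y <;> simp [emb] at *

lemma emb_inj : Function.Injective emb := by
  rintro (⟨_ | x, _ | y⟩ | _ | n) (⟨_ | x', _ | y'⟩ | _ | n') <;> simp [emb] <;> omega

lemma emb_ne (y : ℕ) (hy : 1 ≤ y) (w : W) : emb w ≠ .inl (0, y) := by
  rcases w with (⟨_ | x, _ | y⟩ | _ | n) <;> simp [emb]; omega

lemma emb_E (h : ℕ) (hh : 1 ≤ h) (u v : W) (he : TE h u v) : TE (h+1) (emb u) (emb v) := by
  rcases u with ⟨a, b⟩ | m <;> rcases v with ⟨x, y⟩ | n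
  · simp only [TE] at he
    rw [emb_inl _ _ (by omega), emb_inl _ _ (by omega)]
    simp only [TE]; omega
  · simp only [TE] at he
    obtain ⟨rfl, he⟩ := he
    rw [emb_inl _ _ (by omega)]
    simp only [TE, emb]; omega
  · simp [TE] at he
  · simp only [TE] at he
    subst he
    rcases m with _ | m <;> simp [TE, emb]

/-- From a sequence with the free path going through `(1,0)`, reduce. -/
lemma reduce_core {D h ℓ : ℕ} (hh : 1 ≤ h) (hC : Claim D (h+1) 0)
    (hn : Claim (D+1) h (ℓ+1))
    (P : ℕ → Finset W) (T : ℕ) (hs : SeqG (TE (h+1)) P T) (hT1 : 1 ≤ T)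
    (f : ℕ → ℕ) (hf : IsPath f) (ha : Avoids (h+1) (P 0) f) (hf1 : f 1 = 1)
    (hr : ∀ n, (Sum.inr n : W) ∉ P 0)
    (hnf : ∀ t, 1 ≤ t → t ≤ T → ¬ Full (h+1) (P t))
    (hT : Surr (h+1) ℓ (P T)) (hc : ∀ t ≤ T, (P t).card ≤ h + 1 + D) : False := by
  have hal := teabag_alive hC P T hs hr hc
  have hbl : ∀ t, 1 ≤ t → t ≤ T → ∃ d, 1 ≤ d ∧ (Sum.inl (0, d) : W) ∈ P t := by
    intro t h1 h2
    have hb : ¬ Unbl (h+1) (P t) := by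
      by_cases hex : ∃ n, (Sum.inr n : W) ∈ P t
      · exact hal t h2 hex
      · push Not at hex
        exact fun hu => hnf t h1 h2 ⟨hu, hex⟩
    by_contra hcon
    push Not at hcon
    exact hb ⟨fun _ => 0, ⟨rfl, by simp⟩, fun d hd _ => by simpa using hcon d hd⟩
  -- card bound
  have hcardlt : ∀ t, (∃ d, 1 ≤ d ∧ (Sum.inl (0, d) : W) ∈ P t) →
      ((P t).preimage emb emb_inj.injOn).card < (P t).card := by
    rintro t ⟨d, hd, hm⟩
    have hss : ((P t).preimage emb emb_inj.injOn).map ⟨emb, emb_inj⟩ ⊂ P t := by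
      refine (Finset.ssubset_iff_of_subset ?_).2 ⟨_, hm, ?_⟩
      · intro w hw
        simp only [Finset.mem_map, Finset.mem_preimage, Function.Embedding.coeFn_mk] at hw
        obtain ⟨n, hn, rfl⟩ := hw
        exact hn
      · simp only [Finset.mem_map, Finset.mem_preimage, Function.Embedding.coeFn_mk, not_exists,
          not_and]
        intro w _
        exact emb_ne d hd w
    simpa using Finset.card_lt_card hss
  have hcard : ∀ t ≤ T, ((P t).preimage emb emb_inj.injOn).card < h + 1 + D := by
    intro t ht
    by_cases hex : ∃ d, 1 ≤ d ∧ (Sum.inl (0, d) : W) ∈ P t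
    · exact lt_of_lt_of_le (hcardlt t hex) (hc t ht)
    · have ht0 : t = 0 := by
        by_contra hne
        exact hex (hbl t (by omega) ht)
      subst ht0
      obtain ⟨d, hd, hm⟩ := hbl 1 le_rfl hT1
      have hmn : (Sum.inl (0, d) : W) ∉ P 0 := fun hm' => hex ⟨d, hd, hm'⟩
      have hst := hs 0 hT1
      have hss : P 0 ⊂ P 1 := by
        refine (Finset.ssubset_iff_of_subset ?_).2 ⟨_, hm, hmn⟩
        intro w hw
        by_contra hcon
        have := hst.2 w (Sum.inl (0, d)) (by simp [hw, hcon]) (by simp [hm, hmn])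
        subst this
        exact hmn hw
      have h1 := Finset.card_lt_card hss
      have h2 := hc 1 hT1
      have h3 : ((P 0).preimage emb emb_inj.injOn).card ≤ (P 0).card := by
        classical
        rw [Finset.card_preimage]; exact Finset.card_filter_le _ _
      omega
  have hfle := hf.le
  have hf1le : ∀ d, 1 ≤ f (d+1) := by
    intro d
    induction d with
    | zero => simp [hf1]
    | succ d ih => rcases hf.2 (d+1) with h | h <;> omega
  obtain ⟨t, ht, hbig⟩ := hn (fun t => (P t).preimage emb emb_inj.injOn) T
    (fun t ht => (hs t ht).preimage _ emb_inj (emb_E h hh))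
    (by
      refine ⟨⟨fun d => f (d+1) - 1, ⟨by simp [hf1], fun d => ?_⟩, fun d h1 h2 => ?_⟩, fun n => ?_⟩
      · dsimp only
        have := hf1le d
        rcases hf.2 (d+1) with h | h <;> omega
      · simp only [Finset.mem_preimage]
        have h3 := hf1le d
        have h4 := hfle (d+1)
        rw [emb_inl _ _ (by omega), show f (d+1) - 1 + 1 = f (d+1) by omega,
          show d - (f (d+1) - 1) = d + 1 - f (d+1) by omega]
        exact ha (d+1) (by omega) (by omega)
      · simp only [Finset.mem_preimage]
        rcases n with _ | n
        · have := ha 1 le_rfl (by omega)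
          simpa [emb, hf1] using this
        · simpa [emb] using hr n)
    (by
      rintro (⟨a, b⟩ | m) hu
      · simp [TE] at hu
      · simp only [TE] at hu
        have : m = ℓ := by omega
        subst this
        simp only [Finset.mem_preimage]
        apply hT
        rcases m with _ | m <;> simp [TE, emb])
  have := hcard t ht
  omega

def mir : W → W
  | .inl (x, y) => .inl (y, x)
  | .inr n => .inr n

lemma mir_mir (w : W) : mir (mir w) = w := by
  rcases w with ⟨x, y⟩ | n <;> rfl

lemma mir_inj : Function.Injective mir := fun a b h => by
  rw [← mir_mir a, h, mir_mir]

lemma mir_E (h : ℕ) (u v : W) (he : TE h u v) : TE h (mir u) (mir v) := by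
  rcases u with ⟨a, b⟩ | m <;> rcases v with ⟨x, y⟩ | n <;> simp only [TE, mir] at * <;> omega

lemma mir_card (P : Finset W) : (P.preimage mir mir_inj.injOn).card ≤ P.card := by
  classical
  rw [Finset.card_preimage]; exact Finset.card_filter_le _ _

lemma IsPath.mir {f : ℕ → ℕ} (hf : IsPath f) : IsPath (fun d => d - f d) :=
  ⟨by simp, fun d => by
    have := hf.le d
    rcases hf.2 d with h | h <;> simp only [h] <;> omega⟩

lemma Avoids.mir {h : ℕ} {P : Finset W} {f : ℕ → ℕ} (hf : IsPath f)
    (ha : Avoids h (P.preimage TB.mir mir_inj.injOn) f) : Avoids h P (fun d => d - f d) := by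
  intro d h1 h2 hm
  apply ha d h1 h2
  have := hf.le d
  simpa [TB.mir, show d - (d - f d) = f d by omega] using hm

lemma Avoids.mir' {h : ℕ} {P : Finset W} {f : ℕ → ℕ} (hf : IsPath f)
    (ha : Avoids h P f) : Avoids h (P.preimage TB.mir mir_inj.injOn) (fun d => d - f d) := by
  intro d h1 h2 hm
  apply ha d h1 h2
  have := hf.le d
  simpa [TB.mir, show d - (d - f d) = f d by omega] using hm

lemma claim_reduce {D h ℓ : ℕ} (hh : 1 ≤ h) (hC : Claim D (h+1) 0)
    (hn : Claim (D+1) h (ℓ+1)) : Claim (D+1) (h+1) ℓ := by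
  intro P T hs h0 hT
  by_contra hcon
  push Not at hcon
  obtain ⟨u, hu, hF, hl⟩ := last_full P T h0 (not_full_of_surr (by omega) hT)
  obtain ⟨⟨f, hf, ha⟩, hr⟩ := hF
  have hf0 := hf.1
  rcases hf.2 0 with hf1 | hf1
  · refine reduce_core hh hC hn (fun t => (P (u + t)).preimage mir mir_inj.injOn) (T - u)
      (fun t ht => (hs.shift u t ht).preimage _ mir_inj (mir_E _)) (by omega) _ hf.mir
      (Avoids.mir' hf ha) ?_ ?_ ?_ ?_ ?_
    · simp only [zero_add] at hf1; simp [hf1, hf0]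
    · intro n; simpa [mir] using hr n
    · rintro t h1 h2 ⟨⟨F, hF, hFa⟩, hFr⟩
      exact hl (u+t) (by omega) (by omega) ⟨⟨_, hF.mir, Avoids.mir hF hFa⟩, fun n => by
        simpa [mir] using hFr n⟩
    · intro v hv
      simp only [Finset.mem_preimage, show u + (T - u) = T by omega]
      exact hT _ (mir_E _ _ _ hv)
    · intro t ht
      have h1 := mir_card (P (u+t))
      have h2 := hcon (u+t) (by omega)
      omega
  · refine reduce_core hh hC hn (fun t => P (u + t)) (T - u) (hs.shift u) (by omega) f hf
      ha ?_ hr ?_ ?_ ?_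
    · simpa [hf0] using hf1
    · intro t h1 h2
      exact hl (u+t) (by omega) (by omega)
    · simpa [show u + (T - u) = T by omega] using hT
    · intro t ht
      have := hcon (u+t) (by omega)
      omega

lemma g_succ (n : ℕ) : g (n+2) = 2 ^ (g (n+1) + n) + g (n+1) := rfl

lemma claim_all (n : ℕ) : ∀ h ℓ, g n < h → (1 ≤ n → g (n+1) < h + ℓ) → Claim (n+1) h ℓ := by
  induction n with
  | zero => intro h ℓ h1 _; exact claim_one h ℓ (by omega)
  | succ n ih =>
    have hC : ∀ h, g (n+1) < h → Claim (n+1) h 0 := by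
      intro h hh
      refine ih h 0 ?_ (fun _ => by omega)
      rcases n with _ | n
      · simp [g] at *; omega
      · exact lt_of_le_of_lt (by rw [g_succ]; exact Nat.le_add_left _ _) hh
    have key : ∀ m ℓ, g (n+2) < g (n+1) + 1 + m + ℓ → Claim (n+2) (g (n+1) + 1 + m) ℓ := by
      intro m
      induction m with
      | zero =>
        intro ℓ hl
        refine claim_base (by omega) (hC _ (by omega)) ?_ (by omega)
        rw [g_succ] at hl
        rw [show g (n+1) + 1 + 0 + (n+1) - 2 = g (n+1) + n by omega]
        omega
      | succ m ihm =>
        intro ℓ hl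
        exact claim_reduce (h := g (n+1) + 1 + m) (by omega) (hC _ (by omega)) (ihm (ℓ+1) (by omega))
    intro h ℓ h1 h2
    have h3 : g (n+2) < h + ℓ := h2 (by omega)
    have := key (h - (g (n+1) + 1)) ℓ (by omega)
    rwa [show g (n+1) + 1 + (h - (g (n+1) + 1)) = h by omega] at this

end TB
namespace TB

lemma StepG.map {V W : Type} {E : V → V → Prop} {E' : W → W → Prop} {P P' : Finset V}
    (h : StepG E P P') (φ : V ↪ W)
    (hE : ∀ u' v, E' u' (φ v) → ∃ u, E u v ∧ φ u = u') :
    StepG E' (P.map φ) (P'.map φ) := by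
  have key : ∀ w, (w ∈ P.map φ ↔ w ∉ P'.map φ) → ∃ v, φ v = w ∧ (v ∈ P ↔ v ∉ P') := by
    intro w hw
    by_cases hm : w ∈ P.map φ
    · obtain ⟨v, hv, rfl⟩ := Finset.mem_map.1 hm
      exact ⟨v, rfl, by simpa using hw⟩
    · have : w ∈ P'.map φ := by tauto
      obtain ⟨v, hv, rfl⟩ := Finset.mem_map.1 this
      exact ⟨v, rfl, by simpa using hw⟩
  refine ⟨fun w hw u' hu' => ?_, fun a b ha hb => ?_⟩
  · obtain ⟨v, rfl, hv⟩ := key w hw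
    obtain ⟨u, hu, rfl⟩ := hE u' v hu'
    simpa using h.1 v hv u hu
  · obtain ⟨v, rfl, hv⟩ := key a ha
    obtain ⟨w, rfl, hw⟩ := key b hb
    rw [h.2 v w hv hw]

lemma StepG.of_rev {G : Dgraph} (hirr : ∀ v, ¬ G.edge v v) {P P' : Finset G.V}
    (h : G.RevStep P P') : StepG G.edge P P' := by
  rcases h with ⟨v, hv, hp, rfl⟩ | ⟨v, hv, hp, rfl⟩
  · have key : ∀ w, (w ∈ P ↔ w ∉ insert v P) → w = v := by
      intro w hw
      simp only [Finset.mem_insert] at hw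
      tauto
    refine ⟨fun w hw u hu => ?_, fun a b ha hb => by rw [key a ha, key b hb]⟩
    rw [key w hw] at hu
    exact ⟨hp u hu, Finset.mem_insert_of_mem (hp u hu)⟩
  · have key : ∀ w, (w ∈ P ↔ w ∉ P.erase v) → w = v := by
      intro w hw
      simp only [Finset.mem_erase] at hw
      tauto
    refine ⟨fun w hw u hu => ?_, fun a b ha hb => by rw [key a ha, key b hb]⟩
    rw [key w hw] at hu
    refine ⟨hp u hu, Finset.mem_erase.2 ⟨?_, hp u hu⟩⟩
    rintro rfl
    exact hirr _ hu

/-! ### Existence of a persistent pebbling -/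

lemma exists_max {G : Dgraph} (lev : G.V → ℕ) (hlev : ∀ u v, G.edge u v → lev u < lev v)
    (S : Finset G.V) (hS : S.Nonempty) (hcl : ∀ v ∈ S, ∀ u, G.edge u v → u ∈ S) :
    ∃ v ∈ S, (∀ w ∈ S.erase v, ∀ u, G.edge u w → u ∈ S.erase v) ∧
      ∀ u, G.edge u v → u ∈ S.erase v := by
  obtain ⟨v, hv, hmax⟩ := Finset.exists_max_image S lev hS
  refine ⟨v, hv, ?_, ?_⟩
  · intro w hw u hu
    rw [Finset.mem_erase] at *
    refine ⟨?_, hcl w hw.2 u hu⟩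
    rintro rfl
    have h1 := hlev _ _ hu
    have h2 := hmax w hw.2
    omega
  · intro u hu
    refine Finset.mem_erase.2 ⟨?_, hcl v hv u hu⟩
    rintro rfl
    exact absurd (hlev _ _ hu) (lt_irrefl _)

lemma reach_closed {G : Dgraph} (lev : G.V → ℕ) (hlev : ∀ u v, G.edge u v → lev u < lev v)
    (n : ℕ) : ∀ (S : Finset G.V), S.card = n → (∀ v ∈ S, ∀ u, G.edge u v → u ∈ S) →
      Relation.ReflTransGen G.RevStep ∅ S := by
  induction n with
  | zero => intro S hS _; rw [Finset.card_eq_zero.1 hS]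
  | succ n ih =>
    intro S hS hcl
    obtain ⟨v, hv, h1, h2⟩ := exists_max lev hlev S (Finset.card_pos.1 (by omega)) hcl
    refine (ih (S.erase v) (by rw [Finset.card_erase_of_mem hv]; omega) h1).tail ?_
    exact Or.inl ⟨v, by simp, h2, (Finset.insert_erase hv).symm⟩

lemma reach_down {G : Dgraph} (lev : G.V → ℕ) (hlev : ∀ u v, G.edge u v → lev u < lev v)
    (z : G.V) (n : ℕ) : ∀ (S : Finset G.V), S.card = n → z ∉ S →
      (∀ v ∈ S, ∀ u, G.edge u v → u ∈ S) →
      Relation.ReflTransGen G.RevStep (insert z S) {z} := by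
  induction n with
  | zero => intro S hS _ _; rw [Finset.card_eq_zero.1 hS]; exact Relation.ReflTransGen.refl
  | succ n ih =>
    intro S hS hz hcl
    obtain ⟨v, hv, h1, h2⟩ := exists_max lev hlev S (Finset.card_pos.1 (by omega)) hcl
    have hzv : z ≠ v := by rintro rfl; exact hz hv
    refine Relation.ReflTransGen.head ?_ (ih (S.erase v) (by rw [Finset.card_erase_of_mem hv]; omega)
      (by simp [hz]) h1)
    refine Or.inr ⟨v, by simp [hv], fun u hu => ?_, ?_⟩
    · exact Finset.mem_insert_of_mem (Finset.mem_of_mem_erase (h2 u hu))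
    · rw [Finset.erase_insert_of_ne hzv]

lemma exists_seq {G : Dgraph} {S : Finset G.V} (h : Relation.ReflTransGen G.RevStep ∅ S) :
    ∃ P τ, G.IsRevPebbling P τ ∧ P τ = S := by
  induction h with
  | refl => exact ⟨fun _ => ∅, 0, ⟨rfl, by simp⟩, rfl⟩
  | @tail B C _ hst ih =>
    obtain ⟨P, τ, ⟨h0, hs⟩, hτ⟩ := ih
    refine ⟨fun t => if t ≤ τ then P t else C, τ + 1, ⟨by simp [h0], fun t ht => ?_⟩, by simp⟩
    rcases Nat.lt_or_ge t τ with h | h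
    · simpa [h.le, Nat.succ_le_of_lt h] using hs t h
    · have : t = τ := by omega
      subst this
      simpa [hτ] using hst

lemma exists_pers {G : Dgraph} (lev : G.V → ℕ) (hlev : ∀ u v, G.edge u v → lev u < lev v)
    (z : G.V) (hz : G.IsSink z) : ∃ P τ, G.IsRevPebbling P τ ∧ P τ = {z} := by
  apply exists_seq
  refine (reach_closed lev hlev _ Finset.univ rfl (by simp)).trans ?_
  have := reach_down lev hlev z _ (Finset.univ.erase z) rfl (by simp) (by
    intro v _ u hu
    simp only [Finset.mem_erase, Finset.mem_univ, and_true]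
    rintro rfl
    exact hz _ hu)
  rwa [Finset.insert_erase (Finset.mem_univ z)] at this

/-! ### Transfer -/

def tmap (h ℓ : ℕ) (v : (teabag h ℓ).V) : W :=
  if (v.1.1 : ℕ) < h then .inl ((v.1.2 : ℕ) - (v.1.1 : ℕ), h - (v.1.2 : ℕ))
  else .inr ((v.1.1 : ℕ) - h)

lemma tmap_inj (h ℓ : ℕ) : Function.Injective (tmap h ℓ) := by
  rintro ⟨⟨⟨i, hi⟩, ⟨j, hj⟩⟩, h1, h2⟩ ⟨⟨⟨i', hi'⟩, ⟨j', hj'⟩⟩, h1', h2'⟩ he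
  simp only [tmap] at he
  dsimp only at h1 h2 h1' h2'
  have : i = i' ∧ j = j' := by
    split_ifs at he with c1 c2 c2
    · simp only [Sum.inl.injEq, Prod.mk.injEq] at he
      omega
    · simp only [Sum.inr.injEq] at he
      omega
  obtain ⟨rfl, rfl⟩ := this
  rfl

lemma tmap_lift (h ℓ : ℕ) (hh : 1 ≤ h) (u' : W) (v : (teabag h ℓ).V)
    (he : TE h u' (tmap h ℓ v)) : ∃ u, (teabag h ℓ).edge u v ∧ tmap h ℓ u = u' := by
  obtain ⟨⟨⟨i, hi⟩, ⟨j, hj⟩⟩, h1, h2⟩ := v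
  dsimp only at h1 h2
  simp only [tmap] at he
  -- generic constructor
  have mk : ∀ i' j', i = i' + 1 → (j = j' ∨ j = j' + 1) → (i' ≤ h → i' ≤ j') →
      (h ≤ i' → j' = h) →
      (if i' < h then (Sum.inl (j' - i', h - j') : W) else Sum.inr (i' - h)) = u' →
      ∃ u, (teabag h ℓ).edge u ⟨⟨⟨i, hi⟩, ⟨j, hj⟩⟩, h1, h2⟩ ∧ tmap h ℓ u = u' := by
    intro i' j' e1 e2 e3 e4 e5
    exact ⟨⟨⟨⟨i', by omega⟩, ⟨j', by omega⟩⟩, e3, e4⟩, ⟨e1, e2⟩, e5⟩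
  split_ifs at he with c
  · rcases u' with ⟨a, b⟩ | m
    · simp only [TE] at he
      obtain ⟨_, _, ⟨ha, hb⟩ | ⟨ha, hb⟩⟩ := he
      · refine mk (i-1) j (by omega) (by omega) (by omega) (by omega) ?_
        rw [if_pos (by omega)]
        simp only [Sum.inl.injEq, Prod.mk.injEq]; omega
      · refine mk (i-1) (j-1) (by omega) (by omega) (by omega) (by omega) ?_
        rw [if_pos (by omega)]
        simp only [Sum.inl.injEq, Prod.mk.injEq]; omega
    · simp [TE] at he
  · rcases u' with ⟨a, b⟩ | m
    · simp only [TE] at he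
      obtain ⟨_, ⟨ha, hb⟩ | ⟨ha, hb⟩⟩ := he
      · refine mk (i-1) j (by omega) (by omega) (by omega) (by omega) ?_
        rw [if_pos (by omega)]
        simp only [Sum.inl.injEq, Prod.mk.injEq]; omega
      · refine mk (i-1) (j-1) (by omega) (by omega) (by omega) (by omega) ?_
        rw [if_pos (by omega)]
        simp only [Sum.inl.injEq, Prod.mk.injEq]; omega
    · simp only [TE] at he
      refine mk (i-1) j (by omega) (by omega) (by omega) (by omega) ?_
      rw [if_neg (by omega)]
      simp only [Sum.inr.injEq]; omega

lemma tmap_sink (h ℓ : ℕ) : tmap h ℓ (teabagSink h ℓ) = .inr ℓ := by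
  simp [tmap, teabagSink]

lemma teabag_lev (h ℓ : ℕ) (u v : (teabag h ℓ).V) (he : (teabag h ℓ).edge u v) :
    (u.1.1 : ℕ) < (v.1.1 : ℕ) := by
  have : (v.1.1 : ℕ) = (u.1.1 : ℕ) + 1 := he.1
  omega

lemma teabag_sink (h ℓ : ℕ) : (teabag h ℓ).IsSink (teabagSink h ℓ) := by
  intro u hu
  have h1 : (u.1.1 : ℕ) = h + ℓ + 1 := hu.1
  have h2 := u.1.1.2
  omega

lemma pers_of_claim {D h ℓ : ℕ} (hh : 1 ≤ h) (hC : Claim D h ℓ) :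
    h + D + 1 ≤ (teabag h ℓ).pers (teabagSink h ℓ) := by
  classical
  have hirr : ∀ v, ¬ (teabag h ℓ).edge v v := fun v hv => lt_irrefl _ (teabag_lev h ℓ v v hv)
  unfold Dgraph.pers
  apply le_csInf
  · obtain ⟨P, τ, h1, h2⟩ := exists_pers _ (teabag_lev h ℓ) _ (teabag_sink h ℓ)
    exact ⟨_, P, τ, h1, h2, rfl⟩
  rintro s ⟨P, τ, ⟨h0, hs⟩, hτ, rfl⟩
  set z := teabagSink h ℓ with hz
  by_contra hcon
  have hcard : ∀ t ≤ τ, (P t).card ≤ h + D := by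
    intro t ht
    have : (P t).card ≤ (teabag h ℓ).space P τ :=
      Finset.le_sup (f := fun t => (P t).card) (Finset.mem_range.2 (by omega))
    omega
  have hseq : SeqG (teabag h ℓ).edge P τ := fun t ht => StepG.of_rev hirr (hs t ht)
  -- last time without z
  have hlast : ∃ u < τ, z ∉ P u ∧ ∀ w, u < w → w ≤ τ → z ∈ P w := by
    have aux : ∀ T, z ∈ P T → ∃ u < T, z ∉ P u ∧ ∀ w, u < w → w ≤ T → z ∈ P w := by
      intro T
      induction T with
      | zero => intro hT; simp [h0] at hT
      | succ T ih =>
        intro hT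
        by_cases hF : z ∈ P T
        · obtain ⟨u, hu, h1, h2⟩ := ih hF
          refine ⟨u, by omega, h1, fun w h3 h4 => ?_⟩
          rcases Nat.lt_or_ge T w with h | h
          · rw [show w = T + 1 by omega]; exact hT
          · exact h2 w h3 h
        · refine ⟨T, by omega, hF, fun w h1 h2 => ?_⟩
          rw [show w = T + 1 by omega]; exact hT
    exact aux τ (by simp [hτ])
  obtain ⟨u, hu, hzu, hw⟩ := hlast
  have hz1 := hw (u+1) (by omega) (by omega)
  have hpre : ∀ x, (teabag h ℓ).edge x z → x ∈ P (u+1) := fun x hx =>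
    ((hseq u hu).1 z (by tauto) x hx).2
  obtain ⟨t, ht, hbig⟩ := hC
    (fun i => ((P (τ - i)).filter (fun x => x ≠ z)).map ⟨tmap h ℓ, tmap_inj h ℓ⟩) (τ - (u+1))
    (fun i hi => ((hseq.rev τ le_rfl (τ - (u+1)) (by omega) i hi).filter _ (by
      rintro x y hxy _ rfl
      exact teabag_sink h ℓ _ hxy)).map _ (tmap_lift h ℓ hh))
    (by
      have : (P (τ - 0)).filter (fun x => x ≠ z) = ∅ := by
        simp [hτ, Finset.filter_singleton]
      simp only [this, Finset.map_empty]
      exact ⟨⟨fun _ => 0, ⟨rfl, by simp⟩, by simp [Avoids]⟩, by simp⟩)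
    (by
      intro w hwe
      rw [← tmap_sink] at hwe
      obtain ⟨x, hx, rfl⟩ := tmap_lift h ℓ hh w _ hwe
      simp only [show τ - (τ - (u+1)) = u + 1 by omega, Finset.mem_map, Finset.mem_filter,
        Function.Embedding.coeFn_mk]
      refine ⟨x, ⟨hpre x hx, ?_⟩, rfl⟩
      rintro rfl
      exact hirr _ hx)
  rw [Finset.card_map] at hbig
  have hzt := hw (τ - t) (by omega) (by omega)
  have h1 : (P (τ - t)).filter (fun x => x ≠ z) ⊂ P (τ - t) :=
    (Finset.ssubset_iff_of_subset (Finset.filter_subset _ _)).2 ⟨z, hzt, by simp⟩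
  have h2 := Finset.card_lt_card h1
  have h3 := hcard (τ - t) (by omega)
  omega

end TB

/-- Lower bound on the persistent pebbling price of teabags
(Lemma `lem:teabag-persistent`). -/
theorem teabag_pers_lower (Δ h ℓ : ℕ) (hΔ : 1 ≤ Δ) (hh : 1 ≤ h)
    (hcase : g Δ < h ∨ (2 ≤ Δ ∧ g (Δ - 1) < h ∧ g Δ - h < ℓ)) :
    h + Δ + 1 ≤ (teabag h ℓ).pers (teabagSink h ℓ) := by
  apply TB.pers_of_claim hh
  obtain ⟨n, rfl⟩ : ∃ n, Δ = n + 1 := ⟨Δ - 1, by omega⟩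
  simp only [Nat.add_sub_cancel] at hcase
  apply TB.claim_all n h ℓ
  · rcases hcase with h1 | h1
    · refine lt_of_le_of_lt ?_ h1
      rcases n with _ | n
      · simp [g]
      · rw [TB.g_succ]; exact Nat.le_add_left _ _
    · exact h1.2.1
  · intro _
    omega
end

section
/- Let Δ ≥ 2 be an integer. (1) For every h > g(Δ−1), the persistent pebbling price of the pyramid of height h is at least h + Δ. (2) For h = g(Δ), the visiting price of the pyramid of height h is at least h + Δ. -/
namespace PyrProof

/-- A reversible step on the infinite grid; `(i+1,x)` has predecessors `(i,x)`, `(i,x+1)`. -/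
def Stp (P P' : Finset (ℕ × ℕ)) : Prop :=
  ∃ v : ℕ × ℕ, (∀ i, v.1 = i + 1 → (i, v.2) ∈ P ∧ (i, v.2 + 1) ∈ P) ∧
    ∀ w, w ≠ v → (w ∈ P' ↔ w ∈ P)

theorem Stp.symm {P P' : Finset (ℕ × ℕ)} (h : Stp P P') : Stp P' P := by
  obtain ⟨v, h1, h2⟩ := h
  refine ⟨v, fun i hi => ?_, fun w hw => (h2 w hw).symm⟩
  have := h1 i hi
  constructor
  · rw [h2]; exact this.1
    intro he; rw [← he] at hi; simp at hi
  · rw [h2]; exact this.2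
    intro he; rw [← he] at hi; simp at hi

/-- If membership of `(i+1,x)` changes in a step, both predecessors are present before. -/
theorem Stp.preds {P P' : Finset (ℕ × ℕ)} (h : Stp P P') {i x : ℕ}
    (hc : ¬ ((i + 1, x) ∈ P' ↔ (i + 1, x) ∈ P)) : (i, x) ∈ P ∧ (i, x + 1) ∈ P := by
  obtain ⟨v, h1, h2⟩ := h
  have hv : (i + 1, x) = v := by
    by_contra hne
    exact hc (h2 _ hne)
  subst hv
  exact h1 i rfl

/-- There is an unpebbled path from a source up to and including `(i,x)`. -/
def Op (P : Finset (ℕ × ℕ)) : ℕ → ℕ → Prop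
  | 0, x => (0, x) ∉ P
  | i + 1, x => (i + 1, x) ∉ P ∧ (Op P i x ∨ Op P i (x + 1))

theorem Op.not_mem {P : Finset (ℕ × ℕ)} {i x : ℕ} (h : Op P i x) : (i, x) ∉ P := by
  cases i with
  | zero => exact h
  | succ i => exact h.1

/-- The vertex `(i+1,x)` is open from below. -/
def Ob (P : Finset (ℕ × ℕ)) (i x : ℕ) : Prop := Op P i x ∨ Op P i (x + 1)

/-- Number of pebbles in the subpyramid with apex `(i,x)`. -/
def cnt (P : Finset (ℕ × ℕ)) (i x : ℕ) : ℕ :=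
  (P.filter fun v => v.1 ≤ i ∧ x ≤ v.2 ∧ v.1 + v.2 ≤ i + x).card

/-- Number of pebbles in the subpyramid with apex `(i+1,x)`, without the apex. -/
def cnto (P : Finset (ℕ × ℕ)) (i x : ℕ) : ℕ :=
  (P.filter fun v => v.1 ≤ i ∧ x ≤ v.2 ∧ v.1 + v.2 ≤ i + 1 + x).card

theorem left_diag {P : Finset (ℕ × ℕ)} {i x : ℕ} (h : ¬ Op P i x) : ∃ j ≤ i, (j, x) ∈ P := by
  induction i with
  | zero => exact ⟨0, le_rfl, by simpa [Op] using h⟩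
  | succ i ih =>
    by_cases hm : (i + 1, x) ∈ P
    · exact ⟨i + 1, le_rfl, hm⟩
    · have : ¬ Op P i x := fun ho => h ⟨hm, Or.inl ho⟩
      obtain ⟨j, hj, hj'⟩ := ih this
      exact ⟨j, by omega, hj'⟩

theorem right_diag {P : Finset (ℕ × ℕ)} {i : ℕ} : ∀ {x : ℕ}, ¬ Op P i x →
    ∃ j y, j ≤ i ∧ j + y = i + x ∧ (j, y) ∈ P := by
  induction i with
  | zero => intro x h; exact ⟨0, x, le_rfl, rfl, by simpa [Op] using h⟩
  | succ i ih =>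
    intro x h
    by_cases hm : (i + 1, x) ∈ P
    · exact ⟨i + 1, x, le_rfl, rfl, hm⟩
    · have : ¬ Op P i (x + 1) := fun ho => h ⟨hm, Or.inr ho⟩
      obtain ⟨j, y, hj, hj', hm'⟩ := ih this
      exact ⟨j, y, by omega, by omega, hm'⟩

theorem cnt_pos {P : Finset (ℕ × ℕ)} {i x : ℕ} (h : ¬ Op P i x) : 1 ≤ cnt P i x := by
  obtain ⟨j, hj, hm⟩ := left_diag h
  unfold cnt
  rw [Nat.succ_le_iff, Finset.card_pos]
  refine ⟨(j, x), Finset.mem_filter.2 ⟨hm, ?_⟩⟩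
  simp; omega

theorem cnto_le (P : Finset (ℕ × ℕ)) (i x : ℕ) : cnto P i x ≤ cnt P (i + 1) x := by
  apply Finset.card_le_card
  intro v hv
  simp only [Finset.mem_filter] at hv ⊢
  exact ⟨hv.1, by omega, by omega, by omega⟩

theorem cnto_lt {P : Finset (ℕ × ℕ)} {i x : ℕ} (h : (i + 1, x) ∈ P) :
    cnto P i x + 1 ≤ cnt P (i + 1) x := by
  rw [Nat.succ_le_iff]
  apply Finset.card_lt_card
  rw [Finset.ssubset_iff_of_subset]
  · refine ⟨(i + 1, x), Finset.mem_filter.2 ⟨h, ?_⟩, ?_⟩ <;> simp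
  · intro v hv
    simp only [Finset.mem_filter] at hv ⊢
    exact ⟨hv.1, by omega, by omega, by omega⟩

/-- If `(i+1,x)` is blocked from below, the subpyramid of either predecessor misses a pebble. -/
theorem cnt_lt_cnto {P : Finset (ℕ × ℕ)} {i x y : ℕ} (h : ¬ Ob P i x)
    (hy : y = x ∨ y = x + 1) : cnt P i y + 1 ≤ cnto P i x := by
  rw [Nat.succ_le_iff]
  apply Finset.card_lt_card
  rw [Finset.ssubset_iff_of_subset]
  · rcases hy with rfl | rfl
    · obtain ⟨j, z, h1, h2, h3⟩ := right_diag (fun ho => h (Or.inr ho) : ¬ Op P i (y + 1))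
      refine ⟨(j, z), Finset.mem_filter.2 ⟨h3, ?_⟩, ?_⟩
      · simp only; omega
      · simp only [Finset.mem_filter]; omega
    · obtain ⟨j, h1, h3⟩ := left_diag (fun ho => h (Or.inl ho) : ¬ Op P i x)
      refine ⟨(j, x), Finset.mem_filter.2 ⟨h3, ?_⟩, ?_⟩
      · simp only; omega
      · simp only [Finset.mem_filter]; omega
  · intro v hv
    simp only [Finset.mem_filter] at hv ⊢
    exact ⟨hv.1, by omega, by omega, by omega⟩

/-- Visiting from an open configuration needs `N` pebbles at a blocked time. -/
def Vis (h N : ℕ) : Prop := ∀ (x n : ℕ) (P : ℕ → Finset (ℕ × ℕ)),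
  (∀ t < n, Stp (P t) (P (t + 1))) → Op (P 0) h x → (h, x) ∈ P n →
  ∃ t ≤ n, ¬ Op (P t) h x ∧ N ≤ cnt (P t) h x

/-- Surrounding `(h+1,x)` from an open configuration needs `N` pebbles at a blocked time. -/
def Sur (h N : ℕ) : Prop := ∀ (x n : ℕ) (P : ℕ → Finset (ℕ × ℕ)),
  (∀ t < n, Stp (P t) (P (t + 1))) → Ob (P 0) h x → (h, x) ∈ P n → (h, x + 1) ∈ P n →
  ∃ t ≤ n, ¬ Ob (P t) h x ∧ N ≤ cnto (P t) h x

theorem last_time (p : ℕ → Prop) (n : ℕ) (h0 : p 0) :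
    ∃ a ≤ n, p a ∧ ∀ t, a < t → t ≤ n → ¬ p t := by
  induction n with
  | zero => exact ⟨0, le_rfl, h0, fun t h1 h2 => by omega⟩
  | succ n ih =>
    by_cases hp : p (n + 1)
    · exact ⟨n + 1, le_rfl, hp, fun t h1 h2 => by omega⟩
    · obtain ⟨a, ha, hpa, hl⟩ := ih
      refine ⟨a, by omega, hpa, fun t h1 h2 => ?_⟩
      rcases Nat.lt_or_ge n t with h | h
      · have : t = n + 1 := by omega
        rwa [this]
      · exact hl t h1 h

theorem Vis.toSur {h N : ℕ} (hv : Vis h N) : Sur h (N + 1) := by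
  intro x n P hP h0 hx hx1
  obtain ⟨a, han, hpa, hl⟩ := last_time (fun t => Ob (P t) h x) n h0
  have key : ∀ y, (y = x ∨ y = x + 1) → Op (P a) h y → (h, y) ∈ P n →
      ∃ t ≤ n, ¬ Ob (P t) h x ∧ N + 1 ≤ cnto (P t) h x := by
    intro y hy ho hm
    obtain ⟨t, ht, hno, hc⟩ := hv y (n - a) (fun t => P (a + t))
      (fun t ht => hP (a + t) (by omega)) (by simpa using ho)
      (by simpa [Nat.add_sub_cancel' han] using hm)
    have ht0 : t ≠ 0 := by
      rintro rfl; exact hno (by simpa using ho)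
    have hnb := hl (a + t) (by omega) (by omega)
    refine ⟨a + t, by omega, hnb, ?_⟩
    have := cnt_lt_cnto hnb hy
    omega
  rcases hpa with h1 | h1
  · exact key x (Or.inl rfl) h1 hx
  · exact key (x + 1) (Or.inr rfl) h1 hx1

theorem Sur.toVis {h N : ℕ} (hs : Sur h N) : Vis (h + 1) N := by
  intro x n P hP h0 hx
  classical
  have hex : ∃ b, (h + 1, x) ∈ P b := ⟨n, hx⟩
  obtain ⟨hb, hmin⟩ := And.intro (Nat.find_spec hex) (fun m => @Nat.find_min _ _ hex m)
  have hbn : Nat.find hex ≤ n := Nat.find_min' hex hx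
  generalize Nat.find hex = b at *
  cases b with
  | zero => exact absurd hb h0.not_mem
  | succ b =>
    have hpr := (hP b (by omega)).preds (i := h) (x := x)
      (fun hiff => hmin b (by omega) (hiff.1 hb))
    obtain ⟨t, ht, hno, hc⟩ := hs x b P (fun t ht => hP t (by omega)) h0.2 hpr.1 hpr.2
    exact ⟨t, by omega, fun ho => hno ho.2, hc.trans (cnto_le _ _ _)⟩

theorem Vis.up {k N : ℕ} (hv : Vis k N) (m : ℕ) : Vis (k + m) (N + m) := by
  induction m with
  | zero => exact hv
  | succ m ih => exact ih.toSur.toVis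

theorem Vis.upSur {k N : ℕ} (hv : Vis k N) (m : ℕ) : Sur (k + m) (N + m + 1) :=
  (hv.up m).toSur

/-- Reversible pebbling of a path. -/
theorem path_bound (N : ℕ) : ∀ (β n : ℕ) (E : ℕ → Finset ℕ),
    (∀ t < n, ∃ v, (β + 1 < v → v ≤ β + 2 ^ N → v - 1 ∈ E t) ∧
      ∀ w, w ≠ v → (w ∈ E (t + 1) ↔ w ∈ E t)) →
    (∀ i, β < i → i ≤ β + 2 ^ N → i ∉ E 0) → β + 2 ^ N ∈ E n →
    ∃ t ≤ n, N + 1 ≤ ((E t).filter fun i => β < i ∧ i ≤ β + 2 ^ N).card := by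
  induction N with
  | zero =>
    intro β n E _ _ hm
    refine ⟨n, le_rfl, ?_⟩
    rw [Nat.succ_le_iff, Finset.card_pos]
    exact ⟨_, Finset.mem_filter.2 ⟨hm, by simp⟩⟩
  | succ N ih =>
    intro β n E hE h0 hm
    have h2 : 2 ^ (N + 1) = 2 ^ N + 2 ^ N := by ring
    have hpos : 0 < 2 ^ N := by positivity
    rw [h2] at h0 hm ⊢
    simp only [h2] at hE
    clear h2
    generalize hM : 2 ^ N = m at *
    obtain ⟨a, han, hpa, hl⟩ := last_time
      (fun t => ∀ i, β + m < i → i ≤ β + m + m → i ∉ E t) n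
      (fun i h1 h2 => h0 i (by omega) (by omega))
    have han' : a < n := by
      rcases Nat.lt_or_ge a n with h | h
      · exact h
      · have : a = n := by omega
        subst this
        exact absurd hm (by have := hpa (β + m + m) (by omega) le_rfl; rwa [← Nat.add_assoc])
    -- counting
    have split : ∀ t, ((E t).filter fun i => β < i ∧ i ≤ β + m).card +
        ((E t).filter fun i => β + m < i ∧ i ≤ β + m + m).card ≤
        ((E t).filter fun i => β < i ∧ i ≤ β + (m + m)).card := by
      intro t
      rw [← Finset.card_union_of_disjoint]
      · apply Finset.card_le_card
        intro i hi
        simp only [Finset.mem_union, Finset.mem_filter] at hi ⊢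
        rcases hi with hi | hi
        · exact ⟨hi.1, by omega, by omega⟩
        · exact ⟨hi.1, by omega, by omega⟩
      · rw [Finset.disjoint_left]
        intro i hi hi'
        simp only [Finset.mem_filter] at hi hi'
        omega
    -- the step at time a places β+m+1
    have hma : β + m ∈ E (a + 1) := by
      obtain ⟨v, hv1, hv2⟩ := hE a han'
      have := hl (a + 1) (by omega) (by omega)
      push Not at this
      obtain ⟨i, hi1, hi2, hi3⟩ := this
      have hvi : i = v := by
        by_contra hne
        exact hpa i hi1 hi2 ((hv2 i hne).1 hi3)
      subst hvi
      have hi4 := hv1 (by omega) (by omega)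
      have hi5 : i = β + m + 1 := by
        by_contra hne
        exact hpa (i - 1) (by omega) (by omega) hi4
      subst hi5
      rw [hv2 _ (by omega)]
      simpa using hi4
    have hup : ∀ t, a < t → t ≤ n →
        1 ≤ ((E t).filter fun i => β + m < i ∧ i ≤ β + m + m).card := by
      intro t h1 h2
      have := hl t h1 h2
      push Not at this
      obtain ⟨i, hi1, hi2, hi3⟩ := this
      rw [Nat.succ_le_iff, Finset.card_pos]
      exact ⟨i, Finset.mem_filter.2 ⟨hi3, hi1, hi2⟩⟩
    by_cases hemp : ∃ t, a < t ∧ t ≤ n ∧ ∀ i, β < i → i ≤ β + m → i ∉ E t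
    · obtain ⟨c, hc1, hc2, hc3⟩ := hemp
      obtain ⟨t, ht, hcard⟩ := ih β (c - (a + 1)) (fun t => E (c - t))
        (by
          intro t ht
          obtain ⟨v, hv1, hv2⟩ := hE (c - (t + 1)) (by omega)
          have he : c - (t + 1) + 1 = c - t := by omega
          rw [he] at hv2
          refine ⟨v, fun h1 h2 => ?_, fun w hw => (hv2 w hw).symm⟩
          rw [hv2 _ (by omega)]
          exact hv1 h1 (by omega))
        (by simpa using hc3)
        (by
          have : c - (c - (a + 1)) = a + 1 := by omega
          simp only [this]; exact hma)
      refine ⟨c - t, by omega, ?_⟩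
      have h1 := split (c - t)
      have h2 := hup (c - t) (by omega) (by omega)
      omega
    · push Not at hemp
      obtain ⟨t, ht, hcard⟩ := ih (β + m) (n - a) (fun t => E (a + t))
        (by
          intro t ht
          obtain ⟨v, hv1, hv2⟩ := hE (a + t) (by omega)
          exact ⟨v, fun h1 h2 => hv1 (by omega) (by omega), hv2⟩)
        (by simpa using hpa)
        (by
          have : a + (n - a) = n := by omega
          simp only [this]; rwa [Nat.add_assoc])
      have ht0 : t ≠ 0 := by
        rintro rfl
        have : ((E (a + 0)).filter fun i => β + m < i ∧ i ≤ β + m + m) = ∅ := by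
          rw [Finset.filter_eq_empty_iff]
          intro i hi hi'
          exact hpa i hi'.1 hi'.2 hi
        rw [this] at hcard
        simp at hcard
      refine ⟨a + t, by omega, ?_⟩
      obtain ⟨i, hi1, hi2, hi3⟩ := hemp (a + t) (by omega) (by omega)
      have h1 := split (a + t)
      have h2 : 1 ≤ ((E (a + t)).filter fun i => β < i ∧ i ≤ β + m).card := by
        rw [Nat.succ_le_iff, Finset.card_pos]
        exact ⟨i, Finset.mem_filter.2 ⟨hi3, hi1, hi2⟩⟩
      omega

theorem open_path {P : Finset (ℕ × ℕ)} {h : ℕ} : ∀ {x : ℕ}, Op P h x →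
    ∃ q : ℕ → ℕ, q h = x ∧ (∀ i < h, q i = q (i + 1) ∨ q i = q (i + 1) + 1) ∧
      ∀ i ≤ h, Op P i (q i) := by
  induction h with
  | zero =>
    intro x ho
    exact ⟨fun _ => x, rfl, fun i hi => by omega, fun i hi => by
      have : i = 0 := by omega
      subst this; exact ho⟩
  | succ h ih =>
    intro x ho
    have key : ∀ y, (y = x ∨ y = x + 1) → Op P h y → ∃ q : ℕ → ℕ, q (h + 1) = x ∧
        (∀ i < h + 1, q i = q (i + 1) ∨ q i = q (i + 1) + 1) ∧ ∀ i ≤ h + 1, Op P i (q i) := by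
      intro y hy hoy
      obtain ⟨q, hq1, hq2, hq3⟩ := ih hoy
      refine ⟨fun i => if i ≤ h then q i else x, by simp, fun i hi => ?_, fun i hi => ?_⟩
      · rcases Nat.lt_or_ge i h with h1 | h1
        · have h2 : i ≤ h := by omega
          have h3 : i + 1 ≤ h := by omega
          simp only [h2, h3, if_true]
          exact hq2 i h1
        · have : i = h := by omega
          subst this
          simp [hq1, hy]
      · by_cases h1 : i ≤ h
        · simp only [h1, if_true]; exact hq3 i h1
        · have : i = h + 1 := by omega
          subst this
          simpa using ho
    rcases ho.2 with h1 | h1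
    · exact key x (Or.inl rfl) h1
    · exact key (x + 1) (Or.inr rfl) h1

theorem main_step {k c : ℕ} (hv : Vis k (k + c + 1)) :
    Vis (k + 2 ^ (k + c)) (k + 2 ^ (k + c) + c + 2) := by
  intro x n P hP h0 hx
  have hpow : 0 < 2 ^ (k + c) := by positivity
  obtain ⟨a, han, hpa, hl⟩ := last_time (fun t => Op (P t) (k + 2 ^ (k + c)) x) n h0
  by_contra hcon
  push Not at hcon
  have hsmall : ∀ t, a < t → t ≤ n →
      cnt (P t) (k + 2 ^ (k + c)) x ≤ k + 2 ^ (k + c) + c + 1 := by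
    intro t h1 h2
    have := hcon t h2 (hl t h1 h2)
    omega
  clear hcon
  obtain ⟨q, hq1, hq2, hq3⟩ := open_path hpa
  set h := k + 2 ^ (k + c) with hh
  -- unfrozen and blocked implies blocked everywhere along the path
  have blocked : ∀ t, a < t → t ≤ n →
      (∀ i, k ≤ i → i < h → (i + 1, q (i + 1)) ∈ P t → ¬ Ob (P t) i (q (i + 1))) →
      (∀ i, k ≤ i → i < h → ¬ Ob (P t) i (q (i + 1))) ∧ ¬ Op (P t) k (q k) := by
    intro t h1 h2 hf
    have hop : ∀ d i, i + d = h → k ≤ i → ¬ Op (P t) i (q i) := by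
      intro d
      induction d with
      | zero =>
        intro i hi _ ho
        have : i = h := by omega
        subst this
        rw [hq1] at ho
        exact hl t h1 h2 ho
      | succ d ih =>
        intro i hi hki ho
        have hob : Ob (P t) i (q (i + 1)) := by
          rcases hq2 i (by omega) with he | he
          · left; rwa [← he]
          · right; rwa [← he]
        refine ih (i + 1) (by omega) (by omega) ⟨fun hm => ?_, hob⟩
        exact hf i hki (by omega) hm hob
    refine ⟨fun i hi1 hi2 hob => ?_, hop (h - k) k (by omega) le_rfl⟩
    refine hop (h - (i + 1)) (i + 1) (by omega) (by omega) ⟨fun hm => ?_, hob⟩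
    exact hf i hi1 hi2 hm hob
  have grow : ∀ t, (∀ i, k ≤ i → i < h → ¬ Ob (P t) i (q (i + 1))) →
      ∀ d i, i + d = h → k ≤ i → cnt (P t) i (q i) + d +
        ((Finset.Ioc i h).filter fun j => (j, q j) ∈ P t).card ≤ cnt (P t) h x := by
    intro t hb d
    induction d with
    | zero =>
      intro i hi _
      have : i = h := by omega
      subst this
      simp [hq1]
    | succ d ih =>
      intro i hi hki
      have h1 := ih (i + 1) (by omega) (by omega)
      have h2 := cnt_lt_cnto (hb i hki (by omega)) (hq2 i (by omega))
      have hI : Finset.Ioc i h = insert (i + 1) (Finset.Ioc (i + 1) h) := by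
        ext j; simp only [Finset.mem_Ioc, Finset.mem_insert]; omega
      rw [hI, Finset.filter_insert]
      by_cases hm : (i + 1, q (i + 1)) ∈ P t
      · rw [if_pos hm]
        have h3 := cnto_lt hm
        have h4 := Finset.card_insert_le (i + 1)
          ((Finset.Ioc (i + 1) h).filter fun j => (j, q j) ∈ P t)
        omega
      · rw [if_neg hm]
        have h3 := cnto_le (P t) i (q (i + 1))
        omega
  -- no pebble on the path is ever frozen
  have nofrozen : ∀ t, a ≤ t → t ≤ n → ∀ i, k ≤ i → i < h → (i + 1, q (i + 1)) ∈ P t →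
      ¬ Ob (P t) i (q (i + 1)) := by
    intro t
    induction t using Nat.strong_induction_on with
    | _ t1 ih =>
      intro hat htn M hM1 hM2 hm hob
      have hna : (M + 1, q (M + 1)) ∉ P a := (hq3 (M + 1) (by omega)).not_mem
      have hne : a ≠ t1 := by rintro rfl; exact hna hm
      obtain ⟨d, hd, hpd, hld⟩ := last_time (fun s => (M + 1, q (M + 1)) ∉ P (a + s)) (t1 - a)
        (by simpa using hna)
      have hdlt : d < t1 - a := by
        rcases Nat.lt_or_ge d (t1 - a) with h | h
        · exact h
        · have : a + d = t1 := by omega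
          simp only [this] at hpd
          exact absurd hm hpd
      have hst := hP (a + d) (by omega)
      have hin : (M + 1, q (M + 1)) ∈ P (a + d + 1) := by
        have := hld (d + 1) (by omega) (by omega)
        simpa [Nat.add_assoc] using this
      have hpr := hst.symm.preds (i := M) (x := q (M + 1)) (fun hiff => hpd (hiff.2 hin))
      have hS := hv.upSur (M - k)
      have e1 : k + (M - k) = M := by omega
      rw [e1] at hS
      obtain ⟨t, ht, hno, hc⟩ := hS (q (M + 1)) (t1 - (a + d + 1)) (fun t => P (t1 - t))
        (by
          intro t ht
          have := (hP (t1 - (t + 1)) (by omega)).symm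
          have he : t1 - (t + 1) + 1 = t1 - t := by omega
          rwa [he] at this)
        (by simpa using hob)
        (by
          have : t1 - (t1 - (a + d + 1)) = a + d + 1 := by omega
          simp only [this]; exact hpr.1)
        (by
          have : t1 - (t1 - (a + d + 1)) = a + d + 1 := by omega
          simp only [this]; exact hpr.2)
      have ht0 : t ≠ 0 := by rintro rfl; exact hno (by simpa using hob)
      have hmt : (M + 1, q (M + 1)) ∈ P (t1 - t) := by
        have := hld (t1 - t - a) (by omega) (by omega)
        have e : a + (t1 - t - a) = t1 - t := by omega
        simpa [e] using this
      have hb := blocked (t1 - t) (by omega) (by omega) (ih (t1 - t) (by omega) (by omega) (by omega))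
      have hg := grow (t1 - t) hb.1 (h - (M + 1)) (M + 1) (by omega) (by omega)
      have h1 := cnto_lt hmt
      have h2 := hsmall (t1 - t) (by omega) (by omega)
      omega
  -- now the path
  obtain ⟨t, ht, hcard⟩ := path_bound (k + c) k (n - a)
    (fun t => (Finset.Ioc 0 h).filter fun j => (j, q j) ∈ P (a + t))
    (by
      intro t ht
      obtain ⟨v, hv1, hv2⟩ := hP (a + t) (by omega)
      refine ⟨if v.2 = q v.1 then v.1 else 0, fun h1 h2 => ?_, fun w hw => ?_⟩
      · by_cases he : v.2 = q v.1
        · simp only [he, if_true] at h1 h2 ⊢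
          obtain ⟨i, hi⟩ : ∃ i, v.1 = i + 1 := ⟨v.1 - 1, by omega⟩
          have := hv1 i hi
          rw [hi] at h1 h2 he ⊢
          simp only [Finset.mem_filter, Finset.mem_Ioc, Nat.add_sub_cancel]
          refine ⟨by omega, ?_⟩
          rcases hq2 i (by omega) with h3 | h3
          · rw [h3, ← he]; exact this.1
          · rw [h3, ← he]; exact this.2
        · simp [he] at h1
      · simp only [Finset.mem_filter, Finset.mem_Ioc]
        by_cases hw0 : w = 0
        · subst hw0; simp
        · have : (w, q w) ≠ v := by
            rintro rfl
            simp at hw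
          have e := hv2 _ this
          rw [Nat.add_assoc] at e
          rw [e])
    (by
      intro i _ h2
      simp only [Finset.mem_filter, not_and, Nat.add_zero]
      intro _
      exact (hq3 i h2).not_mem)
    (by
      have : a + (n - a) = n := by omega
      simp only [this, Finset.mem_filter, Finset.mem_Ioc]
      refine ⟨by omega, ?_⟩
      rw [← hh, hq1]; exact hx)
  have ht0 : t ≠ 0 := by
    rintro rfl
    rw [Nat.succ_le_iff] at hcard
    have := lt_of_le_of_lt (Nat.zero_le _) hcard
    rw [Finset.card_pos] at this
    obtain ⟨i, hi⟩ := this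
    simp only [Finset.mem_filter, Finset.mem_Ioc, Nat.add_zero] at hi
    exact (hq3 i (by omega)).not_mem hi.1.2
  have hb := blocked (a + t) (by omega) (by omega) (nofrozen (a + t) (by omega) (by omega))
  have hg := grow (a + t) hb.1 (h - k) k (by omega) le_rfl
  have h1 := cnt_pos hb.2
  have h2 := hsmall (a + t) (by omega) (by omega)
  have h3 : ((((Finset.Ioc 0 h).filter fun j => (j, q j) ∈ P (a + t))).filter
      fun i => k < i ∧ i ≤ k + 2 ^ (k + c)).card ≤
      ((Finset.Ioc k h).filter fun j => (j, q j) ∈ P (a + t)).card := by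
    apply Finset.card_le_card
    intro i hi
    simp only [Finset.mem_filter, Finset.mem_Ioc] at hi ⊢
    exact ⟨⟨hi.2.1, hi.1.1.2⟩, hi.1.2⟩
  omega

theorem vis_g (n : ℕ) : Vis (g (n + 1)) (g (n + 1) + n + 1) := by
  induction n with
  | zero =>
    intro x n P _ _ hx
    have hno : ¬ Op (P n) 0 x := fun ho => ho hx
    exact ⟨n, le_rfl, hno, cnt_pos hno⟩
  | succ n ih =>
    have := main_step ih
    have e : g (n + 1 + 1) = g (n + 1) + 2 ^ (g (n + 1) + n) := by
      rw [g]; ring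
    rw [e]
    exact this

end PyrProof

namespace PyrProof

/-- Translation of pyramid vertices to the grid. -/
def tr (h : ℕ) (v : (pyramid h).V) : ℕ × ℕ := ((v.1.1 : ℕ), (v.1.2 : ℕ) - (v.1.1 : ℕ))

theorem tr_inj (h : ℕ) : Function.Injective (tr h) := by
  rintro ⟨⟨⟨i, hi⟩, ⟨j, hj⟩⟩, hij⟩ ⟨⟨⟨i', hi'⟩, ⟨j', hj'⟩⟩, hij'⟩ he
  simp only [tr, Prod.mk.injEq] at he hij hij'
  have h1 : i = i' := he.1
  have h2 : j = j' := by omega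
  subst h1 h2
  rfl

theorem tr_sink (h : ℕ) : tr h (pyramidSink h) = (h, 0) := by
  simp [tr, pyramidSink]

theorem tr_preds {h : ℕ} {P : Finset (pyramid h).V} {v : (pyramid h).V}
    (hp : ∀ u, (pyramid h).edge u v → u ∈ P) (i : ℕ) (hi : (tr h v).1 = i + 1) :
    (i, (tr h v).2) ∈ P.image (tr h) ∧ (i, (tr h v).2 + 1) ∈ P.image (tr h) := by
  obtain ⟨⟨⟨a, ha⟩, ⟨j, hj⟩⟩, hij⟩ := v
  simp only [tr] at hi hij ⊢
  subst hi
  constructor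
  · rw [Finset.mem_image]
    refine ⟨⟨(⟨i, by omega⟩, ⟨j - 1, by omega⟩), ?_⟩, hp _ ?_, ?_⟩
    · simp only; omega
    · refine ⟨rfl, Or.inr ?_⟩
      simp only; omega
    · simp only [tr, Prod.mk.injEq, true_and]; omega
  · rw [Finset.mem_image]
    refine ⟨⟨(⟨i, by omega⟩, ⟨j, by omega⟩), ?_⟩, hp _ ?_, ?_⟩
    · simp only; omega
    · exact ⟨rfl, Or.inl rfl⟩
    · simp only [tr, Prod.mk.injEq, true_and]; omega

theorem tr_step {h : ℕ} {P P' : Finset (pyramid h).V} (hs : (pyramid h).RevStep P P') :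
    Stp (P.image (tr h)) (P'.image (tr h)) := by
  rcases hs with ⟨v, _, hp, rfl⟩ | ⟨v, _, hp, rfl⟩
  · refine ⟨tr h v, tr_preds hp, fun w hw => ?_⟩
    rw [Finset.image_insert, Finset.mem_insert]
    simp [hw]
  · refine ⟨tr h v, tr_preds hp, fun w hw => ?_⟩
    rw [Finset.image_erase (tr_inj h), Finset.mem_erase]
    simp [hw]

theorem cnt_le_space {h : ℕ} (P : ℕ → Finset (pyramid h).V) {t τ : ℕ} (ht : t ≤ τ) (i x : ℕ) :
    cnt ((P t).image (tr h)) i x ≤ (pyramid h).space P τ := by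
  have h1 : cnt ((P t).image (tr h)) i x ≤ (P t).card :=
    (Finset.card_filter_le _ _).trans Finset.card_image_le
  refine h1.trans ?_
  exact Finset.le_sup (f := fun t => (P t).card) (Finset.mem_range.2 (by omega))

theorem revStep_symm {h : ℕ} {P P' : Finset (pyramid h).V} (hs : (pyramid h).RevStep P P') :
    (pyramid h).RevStep P' P := by
  have irr : ∀ u v, (pyramid h).edge u v → u ≠ v := by
    rintro u v he rfl
    have := he.1
    omega
  rcases hs with ⟨v, hv, hp, rfl⟩ | ⟨v, hv, hp, rfl⟩
  · right
    refine ⟨v, Finset.mem_insert_self _ _, fun u hu => Finset.mem_insert_of_mem (hp u hu), ?_⟩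
    rw [Finset.erase_insert hv]
  · left
    refine ⟨v, Finset.notMem_erase _ _, fun u hu => Finset.mem_erase.2 ⟨irr u v hu, hp u hu⟩, ?_⟩
    rw [Finset.insert_erase hv]

theorem add_level {h m : ℕ} (A : Finset (pyramid h).V)
    (hA : ∀ v : (pyramid h).V, (v.1.1 : ℕ) < m → v ∈ A) (T : Finset (pyramid h).V) :
    (∀ v ∈ T, (v.1.1 : ℕ) = m) → Relation.ReflTransGen (pyramid h).RevStep A (A ∪ T) := by
  induction T using Finset.induction_on with
  | empty => intro _; rw [Finset.union_empty]
  | insert v T hv ih =>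
    intro hT
    have h1 := ih (fun u hu => hT u (Finset.mem_insert_of_mem hu))
    by_cases hm : v ∈ A ∪ T
    · have : A ∪ insert v T = A ∪ T := by
        rw [Finset.union_insert, Finset.insert_eq_self.2 hm]
      rw [this]; exact h1
    · refine h1.tail (Or.inl ⟨v, hm, fun u hu => ?_, Finset.union_insert _ _ _⟩)
      apply Finset.mem_union_left
      apply hA
      have h2 := hT v (Finset.mem_insert_self _ _)
      have h3 := hu.1
      omega

theorem reach_full {h : ℕ} (A : Finset (pyramid h).V) :
    Relation.ReflTransGen (pyramid h).RevStep A Finset.univ := by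
  have key : ∀ m, Relation.ReflTransGen (pyramid h).RevStep A
      (A ∪ Finset.univ.filter fun v : (pyramid h).V => (v.1.1 : ℕ) < m) := by
    intro m
    induction m with
    | zero => simpa using Relation.ReflTransGen.refl
    | succ m ih =>
      refine ih.trans ?_
      have h1 := add_level (m := m)
        (A ∪ Finset.univ.filter fun v : (pyramid h).V => (v.1.1 : ℕ) < m)
        (fun v hv => Finset.mem_union_right _ (Finset.mem_filter.2 ⟨Finset.mem_univ _, hv⟩))
        (Finset.univ.filter fun v : (pyramid h).V => (v.1.1 : ℕ) = m)
        (fun v hv => (Finset.mem_filter.1 hv).2)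
      convert h1 using 1
      ext v
      simp only [Finset.mem_union, Finset.mem_filter, Finset.mem_univ, true_and]
      rw [or_assoc, Nat.lt_succ_iff_lt_or_eq]
  have h1 := key (h + 1)
  have h2 : (A ∪ Finset.univ.filter fun v : (pyramid h).V => (v.1.1 : ℕ) < h + 1)
      = Finset.univ := by
    ext v
    have := v.1.1.isLt
    simp only [Finset.mem_union, Finset.mem_filter, Finset.mem_univ, true_and, iff_true]
    exact Or.inr this
  rwa [h2] at h1

theorem exists_seq {α : Type} {r : α → α → Prop} {a b : α} (hr : Relation.ReflTransGen r a b) :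
    ∃ (P : ℕ → α) (τ : ℕ), P 0 = a ∧ P τ = b ∧ ∀ t < τ, r (P t) (P (t + 1)) := by
  induction hr with
  | refl => exact ⟨fun _ => a, 0, rfl, rfl, fun t ht => by omega⟩
  | @tail b c _ hbc ih =>
    obtain ⟨P, τ, h0, h1, h2⟩ := ih
    refine ⟨fun t => if t ≤ τ then P t else c, τ + 1, by simpa using h0, by simp, ?_⟩
    intro t ht
    rcases Nat.lt_or_ge t τ with h3 | h3
    · have h4 : t ≤ τ := by omega
      have h5 : t + 1 ≤ τ := by omega
      simp only [h4, h5, if_true]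
      exact h2 t h3
    · have : t = τ := by omega
      subst this
      simpa [h1] using hbc

theorem exists_pers (h : ℕ) (z : (pyramid h).V) :
    ∃ P τ, (pyramid h).IsRevPebbling P τ ∧ P τ = {z} := by
  have h1 := reach_full (∅ : Finset (pyramid h).V)
  have h2 := reach_full ({z} : Finset (pyramid h).V)
  have h3 : Relation.ReflTransGen (pyramid h).RevStep Finset.univ {z} :=
    Relation.ReflTransGen.mono (fun _ _ hs => revStep_symm hs) _ _ h2.swap
  obtain ⟨P, τ, p0, p1, p2⟩ := exists_seq (h1.trans h3)
  exact ⟨P, τ, ⟨p0, p2⟩, p1⟩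

theorem op_of_low {Q : Finset (ℕ × ℕ)} : ∀ (i x : ℕ), (∀ j ≤ i, ∀ y, (j, y) ∉ Q) → Op Q i x := by
  intro i
  induction i with
  | zero => intro x hq; exact hq 0 le_rfl x
  | succ i ih =>
    intro x hq
    exact ⟨hq _ le_rfl _, Or.inl (ih x fun j hj y => hq j (by omega) y)⟩

theorem visit_bound {h N : ℕ} (hv : Vis h N) : N ≤ (pyramid h).visit (pyramidSink h) := by
  apply le_csInf
  · obtain ⟨P, τ, h1, h2⟩ := exists_pers h (pyramidSink h)
    exact ⟨_, P, τ, h1, by rw [h2]; exact Finset.mem_singleton_self _, rfl⟩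
  · rintro s ⟨P, τ, ⟨p0, p1⟩, p2, rfl⟩
    obtain ⟨t, ht, _, hc⟩ := hv 0 τ (fun t => (P t).image (tr h)) (fun t ht => tr_step (p1 t ht))
      (op_of_low _ _ fun j _ y => by simp [p0])
      (by rw [← tr_sink h]; exact Finset.mem_image_of_mem _ p2)
    exact hc.trans (cnt_le_space P ht _ _)

theorem pers_bound {M N : ℕ} (hs : Sur M N) :
    N + 1 ≤ (pyramid (M + 1)).pers (pyramidSink (M + 1)) := by
  apply le_csInf
  · obtain ⟨P, τ, h1, h2⟩ := exists_pers (M + 1) (pyramidSink (M + 1))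
    exact ⟨_, P, τ, h1, h2, rfl⟩
  · rintro s ⟨P, τ, ⟨p0, p1⟩, p2, rfl⟩
    have hend : (P τ).image (tr (M + 1)) = {(M + 1, 0)} := by
      rw [p2, Finset.image_singleton, tr_sink]
    have hstep : ∀ t < τ, Stp ((P t).image (tr (M + 1))) ((P (t + 1)).image (tr (M + 1))) :=
      fun t ht => tr_step (p1 t ht)
    have hcs : ∀ t ≤ τ, cnt ((P t).image (tr (M + 1))) (M + 1) 0 ≤ (pyramid (M + 1)).space P τ :=
      fun t ht => cnt_le_space P ht _ _
    have hbeg : (P 0).image (tr (M + 1)) = ∅ := by rw [p0, Finset.image_empty]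
    generalize (pyramid (M + 1)).space P τ = s at *
    obtain ⟨Q, hQ⟩ : ∃ Q : ℕ → Finset (ℕ × ℕ), ∀ t, (P t).image (tr (M + 1)) = Q t :=
      ⟨_, fun _ => rfl⟩
    simp only [hQ] at hend hstep hcs hbeg
    obtain ⟨d, hd, hpd, hld⟩ := last_time (fun t => (M + 1, 0) ∉ Q t) τ (by simp [hbeg])
    have hdτ : d ≠ τ := by
      rintro rfl
      simp [hend] at hpd
    have hin : (M + 1, 0) ∈ Q (d + 1) := by
      have := hld (d + 1) (by omega) (by omega)
      simpa using this
    have hpr := (hstep d (by omega)).symm.preds (i := M) (x := 0) (fun hiff => hpd (hiff.2 hin))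
    have e : τ - (τ - (d + 1)) = d + 1 := by omega
    have hob : Ob (Q τ) M 0 := Or.inl (op_of_low _ _ fun j hj y => by
      rw [hend]; simp; omega)
    obtain ⟨t, ht, hno, hc⟩ := hs 0 (τ - (d + 1)) (fun t => Q (τ - t))
      (by
        intro t ht
        have := (hstep (τ - (t + 1)) (by omega)).symm
        have he : τ - (t + 1) + 1 = τ - t := by omega
        rwa [he] at this)
      (by simpa using hob)
      (by simp only [e]; exact hpr.1)
      (by simp only [e]; exact hpr.2)
    have hmt : (M + 1, 0) ∈ Q (τ - t) := by
      have := hld (τ - t) (by omega) (by omega)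
      simpa using this
    have h1 := cnto_lt hmt
    have h2 := hcs (τ - t) (by omega)
    omega

end PyrProof

/-- Lower bounds for pyramids: persistent price for `h > g(Δ-1)` and visiting price for
`h = g(Δ)` (Corollary after Lemma `lem:teabag-persistent`). -/
theorem pyramid_lower_bounds (Δ : ℕ) (hΔ : 2 ≤ Δ) :
    (∀ h : ℕ, g (Δ - 1) < h → h + Δ ≤ (pyramid h).pers (pyramidSink h)) ∧
    g Δ + Δ ≤ (pyramid (g Δ)).visit (pyramidSink (g Δ)) := by
  obtain ⟨n, rfl⟩ : ∃ n, Δ = n + 2 := ⟨Δ - 2, by omega⟩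
  constructor
  · intro h hh
    have e0 : n + 2 - 1 = n + 1 := rfl
    rw [e0] at hh
    obtain ⟨m, rfl⟩ : ∃ m, h = g (n + 1) + m + 1 := ⟨h - g (n + 1) - 1, by omega⟩
    have h1 := PyrProof.pers_bound ((PyrProof.vis_g n).upSur m)
    omega
  · have h1 := PyrProof.visit_bound (PyrProof.vis_g (n + 1))
    exact h1
end

section
/- For every integer p ≥ 1 there exists a DAG G_p with a unique sink, in-degree at most 2, at most p² vertices, and persistent pebbling price Pers(G_p) = p. -/
/-! ## Subgraphs of pyramids, as finite lower sets of `ℕ × ℕ` -/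

namespace PyrAux

/-- `E u v`: `u` is an immediate predecessor of `v`. -/
def E (u v : ℕ × ℕ) : Prop := u = (v.1 + 1, v.2) ∨ u = (v.1, v.2 + 1)

/-- The graph on a finite set of cells. -/
def Gr (S : Finset (ℕ × ℕ)) : Dgraph where
  V := {x // x ∈ S}
  edge u v := E u.1 v.1

/-- A cell as a vertex. -/
def mk {S : Finset (ℕ × ℕ)} {v : ℕ × ℕ} (hv : v ∈ S) : (Gr S).V := (⟨v, hv⟩ : {x // x ∈ S})

lemma mk_eq {S : Finset (ℕ × ℕ)} {v : ℕ × ℕ} (hv : v ∈ S) (w : (Gr S).V) :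
    mk hv = w ↔ v = w.1 := Subtype.ext_iff

/-- One reversible step, on plain sets of cells. -/
def Step (S A B : Finset (ℕ × ℕ)) : Prop :=
  ∃ v ∈ S, (∀ u ∈ S, E u v → u ∈ A) ∧ ((v ∉ A ∧ B = insert v A) ∨ (v ∈ A ∧ B = A.erase v))

/-- A step in space `k`. -/
def KStep (S : Finset (ℕ × ℕ)) (k : ℕ) (A B : Finset (ℕ × ℕ)) : Prop :=
  Step S A B ∧ A.card ≤ k ∧ B.card ≤ k

/-- `A` is reachable in space `k`. -/
def Reach (S : Finset (ℕ × ℕ)) (k : ℕ) (A : Finset (ℕ × ℕ)) : Prop :=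
  Relation.ReflTransGen (KStep S k) ∅ A

/-- An unpebbled path of length `h` leads into `(i, j)`. -/
def Opn (P : Finset (ℕ × ℕ)) : ℕ → ℕ → ℕ → Prop
  | 0, i, j => (i, j) ∉ P
  | h + 1, i, j => (i, j) ∉ P ∧ (Opn P h (i + 1) j ∨ Opn P h i (j + 1))

lemma Opn.not_mem {P : Finset (ℕ × ℕ)} {h i j : ℕ} (H : Opn P h i j) : (i, j) ∉ P := by
  cases h with
  | zero => exact H
  | succ h => exact H.1

lemma Opn.mono {P Q : Finset (ℕ × ℕ)} (hQ : Q ⊆ P) {h i j : ℕ} (H : Opn P h i j) :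
    Opn Q h i j := by
  induction h generalizing i j with
  | zero => exact fun hh => H (hQ hh)
  | succ h ih => exact ⟨fun hh => H.1 (hQ hh), H.2.imp ih ih⟩

lemma opn_empty (h i j : ℕ) : Opn ∅ h i j := by
  induction h generalizing i j with
  | zero => simp [Opn]
  | succ h ih => exact ⟨by simp, Or.inl (ih _ _)⟩

lemma exists_col {P : Finset (ℕ × ℕ)} {h i j : ℕ} (H : ¬ Opn P h i j) :
    ∃ b, j ≤ b ∧ (i, b) ∈ P := by
  induction h generalizing j with
  | zero => exact ⟨j, le_rfl, by simpa [Opn] using H⟩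
  | succ h ih =>
    by_cases hm : (i, j) ∈ P
    · exact ⟨j, le_rfl, hm⟩
    · obtain ⟨b, hb, hb'⟩ := ih (j := j + 1) (fun h2 => H ⟨hm, Or.inr h2⟩)
      exact ⟨b, by omega, hb'⟩

lemma exists_row {P : Finset (ℕ × ℕ)} {h i j : ℕ} (H : ¬ Opn P h i j) :
    ∃ a, i ≤ a ∧ (a, j) ∈ P := by
  induction h generalizing i with
  | zero => exact ⟨i, le_rfl, by simpa [Opn] using H⟩
  | succ h ih =>
    by_cases hm : (i, j) ∈ P
    · exact ⟨i, le_rfl, hm⟩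
    · obtain ⟨b, hb, hb'⟩ := ih (i := i + 1) (fun h2 => H ⟨hm, Or.inl h2⟩)
      exact ⟨b, by omega, hb'⟩

/-- Blocking the last open path requires many pebbles. -/
lemma card_of_block {P : Finset (ℕ × ℕ)} {v : ℕ × ℕ} {H : ℕ}
    (hv : v.1 + v.2 < H → (v.1 + 1, v.2) ∈ P ∧ (v.1, v.2 + 1) ∈ P)
    {h i j : ℕ} (hH : i + j + h = H) (ho : Opn P h i j) (hn : ¬ Opn (insert v P) h i j) :
    h + 1 ≤ ((insert v P).filter (fun x => i ≤ x.1 ∧ j ≤ x.2)).card := by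
  induction h generalizing i j with
  | zero =>
    have : (i, j) ∈ insert v P := by simpa only [Opn, not_not] using hn
    apply Finset.card_pos.mpr
    exact ⟨(i, j), by simp only [Finset.mem_filter]; exact ⟨this, le_rfl, le_rfl⟩⟩
  | succ h ih =>
    have hm : (i, j) ∉ insert v P := by
      intro hm
      rcases Finset.mem_insert.mp hm with hm | hm
      · subst hm
        have := hv (by simp only; omega)
        rcases ho.2 with h2 | h2
        · exact h2.not_mem this.1
        · exact h2.not_mem this.2
      · exact ho.1 hm
    have hn1 : ¬ Opn (insert v P) h (i + 1) j := fun h2 => hn ⟨hm, Or.inl h2⟩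
    have hn2 : ¬ Opn (insert v P) h i (j + 1) := fun h2 => hn ⟨hm, Or.inr h2⟩
    rcases ho.2 with h2 | h2
    · have h3 := ih (by omega) h2 hn1
      obtain ⟨b, hb, hb'⟩ := exists_col hn2
      refine lt_of_le_of_lt h3 (Finset.card_lt_card ?_)
      rw [Finset.ssubset_iff]
      refine ⟨(i, b), by simp, ?_⟩
      intro x hx
      simp only [Finset.mem_insert, Finset.mem_filter] at hx hb' ⊢
      rcases hx with rfl | hx
      · exact ⟨hb', le_rfl, by simp only; omega⟩
      · exact ⟨hx.1, by omega, hx.2.2⟩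
    · have h3 := ih (by omega) h2 hn2
      obtain ⟨b, hb, hb'⟩ := exists_row hn1
      refine lt_of_le_of_lt h3 (Finset.card_lt_card ?_)
      rw [Finset.ssubset_iff]
      refine ⟨(b, j), by simp, ?_⟩
      intro x hx
      simp only [Finset.mem_insert, Finset.mem_filter] at hx hb' ⊢
      rcases hx with rfl | hx
      · exact ⟨hb', by simp only; omega, le_rfl⟩
      · exact ⟨hx.1, hx.2.1, by omega⟩

/-- The pyramid of height `h`. -/
def Stair (h : ℕ) : Finset (ℕ × ℕ) :=
  (Finset.range (h + 1) ×ˢ Finset.range (h + 1)).filter (fun x => x.1 + x.2 ≤ h)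

lemma mem_stair {h : ℕ} {x : ℕ × ℕ} : x ∈ Stair h ↔ x.1 + x.2 ≤ h := by
  simp only [Stair, Finset.mem_filter, Finset.mem_product, Finset.mem_range]
  omega

lemma stair_lower {h : ℕ} : ¬ Reach (Stair h) h {(0, 0)} := by
  have key : ∀ A, Reach (Stair h) h A → Opn A h 0 0 := by
    intro A hA
    induction hA with
    | refl => exact opn_empty _ _ _
    | @tail B C _ hs ih =>
      obtain ⟨⟨v, hvS, hp, hc⟩, -, hC⟩ := hs
      rcases hc with ⟨hv, rfl⟩ | ⟨hv, rfl⟩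
      · by_contra hcon
        have hv' : v.1 + v.2 < h → (v.1 + 1, v.2) ∈ B ∧ (v.1, v.2 + 1) ∈ B := by
          intro hlt
          refine ⟨hp _ (mem_stair.mpr ?_) (Or.inl rfl), hp _ (mem_stair.mpr ?_) (Or.inr rfl)⟩
          · simp only; omega
          · simp only; omega
        have := card_of_block hv' (by omega) ih hcon
        have h2 := Finset.card_filter_le (insert v B) (fun x => 0 ≤ x.1 ∧ 0 ≤ x.2)
        omega
      · exact ih.mono (Finset.erase_subset _ _)
  intro hr
  exact (key _ hr).not_mem (by simp)

/-- Adding a source increases the price by at most one. -/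
lemma reach_insert {S : Finset (ℕ × ℕ)} {c : ℕ × ℕ} {k : ℕ} (hc : c ∉ S) (hc0 : c ≠ (0, 0))
    (hmax : ∀ u ∈ insert c S, ¬ E u c) (hr : Reach S k {(0, 0)}) :
    Reach (insert c S) (k + 1) {(0, 0)} := by
  have h1 : Relation.ReflTransGen (KStep (insert c S) (k + 1)) (insert c ∅) (insert c {(0, 0)}) := by
    refine Relation.ReflTransGen.lift (p := KStep (insert c S) (k + 1)) (insert c) ?_ _ _ hr
    rintro A B ⟨⟨v, hv, hp, hcase⟩, hA, hB⟩
    have hvc : v ≠ c := fun h => hc (h ▸ hv)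
    refine ⟨⟨v, Finset.mem_insert_of_mem hv, ?_, ?_⟩, ?_, ?_⟩
    · intro u hu he
      rcases Finset.mem_insert.mp hu with rfl | hu
      · exact Finset.mem_insert_self _ _
      · exact Finset.mem_insert_of_mem (hp u hu he)
    · rcases hcase with ⟨hvA, rfl⟩ | ⟨hvA, rfl⟩
      · left
        exact ⟨by simp [hvc, hvA], Finset.insert_comm _ _ _⟩
      · right
        exact ⟨by simp [hvA], by rw [Finset.erase_insert_of_ne hvc.symm]⟩
    · exact (Finset.card_insert_le _ _).trans (by omega)
    · exact (Finset.card_insert_le _ _).trans (by omega)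
  have hk : 1 ≤ k := by
    rcases Relation.ReflTransGen.cases_tail hr with h | ⟨_, _, h⟩
    · simp at h
    · simpa using h.2.2
  have hs : KStep (insert c S) (k + 1) ∅ (insert c ∅) := by
    refine ⟨⟨c, by simp, fun u hu he => absurd he (hmax u hu), Or.inl ⟨by simp, rfl⟩⟩, by simp, by simp⟩
  have he : KStep (insert c S) (k + 1) (insert c {(0, 0)}) {(0, 0)} := by
    refine ⟨⟨c, by simp, fun u hu he => absurd he (hmax u hu), Or.inr ⟨by simp, ?_⟩⟩, ?_, by simp⟩
    · rw [Finset.erase_insert (by simpa using hc0)]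
    · exact (Finset.card_insert_le _ _).trans (by simpa using hk)
  exact (Relation.ReflTransGen.head hs h1).tail he

/-- The underlying set of cells of a configuration. -/
def up (S : Finset (ℕ × ℕ)) (P : Finset (Gr S).V) : Finset (ℕ × ℕ) :=
  Finset.map (Function.Embedding.subtype (fun x => x ∈ S)) P

lemma up_card (S : Finset (ℕ × ℕ)) (P : Finset (Gr S).V) : (up S P).card = P.card :=
  Finset.card_map _

lemma mem_up {S : Finset (ℕ × ℕ)} {P : Finset (Gr S).V} {v : ℕ × ℕ} (hv : v ∈ S) :
    v ∈ up S P ↔ mk hv ∈ P := by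
  constructor
  · intro h
    obtain ⟨w, hw, rfl⟩ := Finset.mem_map.mp h
    exact hw
  · intro h
    exact Finset.mem_map.mpr ⟨_, h, rfl⟩

lemma up_sub {S : Finset (ℕ × ℕ)} {P : Finset (Gr S).V} {v : ℕ × ℕ} (h : v ∈ up S P) : v ∈ S := by
  obtain ⟨w, hw, rfl⟩ := Finset.mem_map.mp h
  exact w.2

lemma up_inj {S : Finset (ℕ × ℕ)} {P Q : Finset (Gr S).V} (h : up S P = up S Q) : P = Q :=
  Finset.map_injective _ h

lemma up_insert {S : Finset (ℕ × ℕ)} (P : Finset (Gr S).V) (v : (Gr S).V) :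
    up S (insert v P) = insert v.1 (up S P) := by
  ext x
  by_cases hx : x ∈ S
  · rw [mem_up hx, Finset.mem_insert, Finset.mem_insert, mem_up hx]
    exact or_congr_left (mk_eq hx v)
  · constructor
    · intro h
      exact absurd (up_sub h) hx
    · intro h
      rcases Finset.mem_insert.mp h with rfl | h
      · exact absurd v.2 hx
      · exact absurd (up_sub h) hx

lemma up_erase {S : Finset (ℕ × ℕ)} (P : Finset (Gr S).V) (v : (Gr S).V) :
    up S (P.erase v) = (up S P).erase v.1 := by
  ext x
  by_cases hx : x ∈ S
  · rw [mem_up hx, Finset.mem_erase, Finset.mem_erase, mem_up hx]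
    exact and_congr_left fun _ => not_congr (mk_eq hx v)
  · constructor
    · intro h
      exact absurd (up_sub h) hx
    · intro h
      exact absurd (up_sub (Finset.mem_of_mem_erase h)) hx

lemma step_up {S : Finset (ℕ × ℕ)} {P Q : Finset (Gr S).V} (h : (Gr S).RevStep P Q) :
    Step S (up S P) (up S Q) := by
  rcases h with ⟨v, hv, hp, rfl⟩ | ⟨v, hv, hp, rfl⟩
  · exact ⟨v.1, v.2, fun u hu he => (mem_up hu).mpr (hp ⟨u, hu⟩ he),
      Or.inl ⟨fun h => hv ((mem_up v.2).mp h), up_insert _ _⟩⟩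
  · exact ⟨v.1, v.2, fun u hu he => (mem_up hu).mpr (hp ⟨u, hu⟩ he),
      Or.inr ⟨(mem_up v.2).mpr hv, up_erase _ _⟩⟩

lemma step_down {S : Finset (ℕ × ℕ)} {P : Finset (Gr S).V} {B : Finset (ℕ × ℕ)}
    (h : Step S (up S P) B) : ∃ Q, up S Q = B ∧ (Gr S).RevStep P Q := by
  obtain ⟨v, hv, hp, hc⟩ := h
  let w : (Gr S).V := mk hv
  have hp' : ∀ u : (Gr S).V, (Gr S).edge u w → u ∈ P :=
    fun u he => (mem_up u.2).mp (hp u.1 u.2 he)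
  rcases hc with ⟨h1, rfl⟩ | ⟨h1, rfl⟩
  · exact ⟨insert w P, up_insert P w, Or.inl ⟨w, fun h => h1 ((mem_up hv).mpr h), hp', rfl⟩⟩
  · exact ⟨P.erase w, up_erase P w, Or.inr ⟨w, (mem_up hv).mp h1, hp', rfl⟩⟩

lemma reach_of_peb {S : Finset (ℕ × ℕ)} {k : ℕ} {P : ℕ → Finset (Gr S).V} {τ : ℕ}
    (hP : (Gr S).IsRevPebbling P τ) (hs : (Gr S).space P τ ≤ k) :
    Reach S k (up S (P τ)) := by
  have hcard : ∀ t ≤ τ, (P t).card ≤ k := by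
    intro t ht
    refine le_trans ?_ hs
    exact Finset.le_sup (f := fun t => (P t).card) (Finset.mem_range.mpr (by omega))
  have : ∀ t ≤ τ, Reach S k (up S (P t)) := by
    intro t
    induction t with
    | zero =>
      intro _
      rw [hP.1]
      exact Relation.ReflTransGen.refl
    | succ t ih =>
      intro ht
      refine Relation.ReflTransGen.tail (ih (by omega)) ⟨step_up (hP.2 t (by omega)), ?_, ?_⟩
      · rw [up_card]; exact hcard t (by omega)
      · rw [up_card]; exact hcard _ ht
  exact this τ le_rfl

lemma peb_of_reach {S : Finset (ℕ × ℕ)} {k : ℕ} {A : Finset (ℕ × ℕ)} (h : Reach S k A) :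
    ∃ P τ, (Gr S).IsRevPebbling P τ ∧ up S (P τ) = A ∧ (Gr S).space P τ ≤ k := by
  induction h with
  | refl =>
    refine ⟨fun _ => ∅, 0, ⟨rfl, by simp⟩, rfl, ?_⟩
    simp [Dgraph.space]
  | @tail B C _ hs ih =>
    obtain ⟨P, τ, ⟨h0, hP⟩, hB, hsp⟩ := ih
    obtain ⟨hst, -, hC⟩ := hs
    rw [← hB] at hst
    obtain ⟨Q, hQ, hstep⟩ := step_down hst
    refine ⟨fun t => if t ≤ τ then P t else Q, τ + 1, ⟨by simpa using h0, ?_⟩, by simpa using hQ, ?_⟩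
    · intro t ht
      rcases Nat.lt_succ_iff_lt_or_eq.mp ht with h | rfl
      · have h1 : t ≤ τ := by omega
        have h2 : t + 1 ≤ τ := by omega
        simp only [h1, h2, if_true]
        exact hP t h
      · simpa using hstep
    · apply Finset.sup_le
      intro t ht
      by_cases h : t ≤ τ
      · simp only [h, if_true]
        refine le_trans ?_ hsp
        exact Finset.le_sup (f := fun t => (P t).card) (Finset.mem_range.mpr (by omega))
      · simp only [h, if_false]
        rw [← up_card, hQ]
        exact hC

lemma up_single {S : Finset (ℕ × ℕ)} (v : (Gr S).V) : up S {v} = {v.1} :=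
  Finset.map_singleton _ _

lemma pers_eq {S : Finset (ℕ × ℕ)} (h0 : (0, 0) ∈ S) {p : ℕ} (hp : 1 ≤ p)
    (h1 : Reach S p {(0, 0)}) (h2 : ¬ Reach S (p - 1) {(0, 0)}) :
    (Gr S).pers (mk h0) = p := by
  have hlow : ∀ s ∈ { s : ℕ | ∃ P τ, (Gr S).IsRevPebbling P τ ∧
      P τ = {mk h0} ∧ (Gr S).space P τ = s }, p ≤ s := by
    rintro s ⟨P, τ, hP, hz, hs⟩
    by_contra hlt
    apply h2
    have := reach_of_peb (k := p - 1) hP (by omega)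
    rw [hz] at this
    exact this
  obtain ⟨P, τ, hP, hz, hs⟩ := peb_of_reach h1
  have hz' : P τ = {mk h0} := up_inj (hz.trans (up_single (mk h0)).symm)
  apply le_antisymm
  · exact le_trans (Nat.sInf_le ⟨P, τ, hP, hz', rfl⟩) hs
  · exact le_csInf ⟨_, P, τ, hP, hz', rfl⟩ hlow

/-- Lower sets of cells. -/
def Low (S : Finset (ℕ × ℕ)) : Prop :=
  ∀ a b, ((a + 1, b) ∈ S → (a, b) ∈ S) ∧ ((a, b + 1) ∈ S → (a, b) ∈ S)

lemma acyclic_Gr (S : Finset (ℕ × ℕ)) : (Gr S).Acyclic := by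
  intro v hv
  have : ∀ u w : (Gr S).V, Relation.TransGen (Gr S).edge u w → w.1.1 + w.1.2 < u.1.1 + u.1.2 := by
    have hE : ∀ u w : (Gr S).V, (Gr S).edge u w → w.1.1 + w.1.2 < u.1.1 + u.1.2 := by
      intro u w h
      rcases h with h | h <;> rw [h] <;> simp only <;> omega
    intro u w h
    induction h with
    | single h => exact hE _ _ h
    | tail _ h ih => exact (hE _ _ h).trans ih
  exact lt_irrefl _ (this v v hv)

lemma sink_Gr {S : Finset (ℕ × ℕ)} (hS : Low S) (h0 : (0, 0) ∈ S) :
    (Gr S).UniqueSink (mk h0) := by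
  constructor
  · intro u h
    rcases h with h | h
    · have h3 : 0 = u.1.1 + 1 := congrArg Prod.fst h
      omega
    · have h3 : 0 = u.1.2 + 1 := congrArg Prod.snd h
      omega
  · rintro ⟨⟨a, b⟩, hw⟩ hs
    cases a with
    | succ a => exact absurd (Or.inl rfl) (hs ⟨(a, b), (hS a b).1 hw⟩)
    | zero =>
      cases b with
      | succ b => exact absurd (Or.inr rfl) (hs ⟨(0, b), (hS 0 b).2 hw⟩)
      | zero => rfl

lemma indeg_Gr (S : Finset (ℕ × ℕ)) : (Gr S).InDegLe2 := by
  intro v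
  have hsub : Subtype.val '' {u : (Gr S).V | (Gr S).edge u v} ⊆
      ({(v.1.1 + 1, v.1.2), (v.1.1, v.1.2 + 1)} : Set (ℕ × ℕ)) := by
    rintro _ ⟨u, hu, rfl⟩
    exact hu
  have hi := Set.ncard_image_of_injective {u : (Gr S).V | (Gr S).edge u v}
    (f := fun u : (Gr S).V => u.1) Subtype.val_injective
  rw [← hi]
  exact (Set.ncard_le_ncard hsub (Set.toFinite _)).trans ((Set.ncard_insert_le _ _).trans (by rw [Set.ncard_singleton]))

lemma exists_set (p : ℕ) (hp : 1 ≤ p) : ∃ S : Finset (ℕ × ℕ), Low S ∧ (0, 0) ∈ S ∧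
    S.card ≤ p ^ 2 ∧ Reach S p {(0, 0)} ∧ ¬ Reach S (p - 1) {(0, 0)} := by
  let T : Finset (ℕ × ℕ) → Prop := fun S => Low S ∧ (0, 0) ∈ S ∧
    S.card ≤ p ^ 2 ∧ ¬ Reach S (p - 1) {(0, 0)}
  have hT : ∃ n S, S.card = n ∧ T S := by
    refine ⟨_, Stair (p - 1), rfl, ?_, ?_, ?_, stair_lower⟩
    · intro a b
      simp only [mem_stair]
      omega
    · simp [mem_stair]
    · refine (Finset.card_filter_le _ _).trans ?_
      rw [Finset.card_product, Finset.card_range, Nat.sub_add_cancel hp, sq]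
  classical
  obtain ⟨S, hSn, hL, h0, hc, hn⟩ := Nat.find_spec hT
  have hmin : ∀ S', S'.card < S.card → ¬ T S' := by
    intro S' hlt hS'
    exact Nat.find_min hT (hSn ▸ hlt) ⟨S', rfl, hS'⟩
  refine ⟨S, hL, h0, hc, ?_, hn⟩
  obtain ⟨c, hcS, hcmax⟩ := Finset.exists_max_image S (fun x => x.1 + x.2) ⟨_, h0⟩
  have hsrc : ∀ u ∈ S, ¬ E u c := by
    intro u hu he
    have := hcmax u hu
    rcases he with rfl | rfl <;> simp only at this <;> omega
  by_cases hc0 : c = (0, 0)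
  · subst hc0
    refine Relation.ReflTransGen.single ⟨⟨(0, 0), h0, fun u hu he => absurd he (hsrc u hu),
      Or.inl ⟨by simp, by simp⟩⟩, by simp, by simpa using hp⟩
  · have hnT := hmin (S.erase c) (Finset.card_erase_lt_of_mem hcS)
    have hr : Reach (S.erase c) (p - 1) {(0, 0)} := by
      by_contra hcon
      apply hnT
      refine ⟨?_, ?_, ?_, hcon⟩
      · intro a b
        constructor
        · intro h
          have h' := Finset.mem_of_mem_erase h
          refine Finset.mem_erase.mpr ⟨?_, (hL a b).1 h'⟩
          rintro rfl
          exact hsrc _ h' (Or.inl rfl)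
        · intro h
          have h' := Finset.mem_of_mem_erase h
          refine Finset.mem_erase.mpr ⟨?_, (hL a b).2 h'⟩
          rintro rfl
          exact hsrc _ h' (Or.inr rfl)
      · exact Finset.mem_erase.mpr ⟨Ne.symm hc0, h0⟩
      · exact (Finset.card_le_card (Finset.erase_subset _ _)).trans hc
    have := reach_insert (c := c) (by simp) hc0
      (by rw [Finset.insert_erase hcS]; exact hsrc) hr
    rwa [Finset.insert_erase hcS, Nat.sub_add_cancel hp] at this

end PyrAux

/-- Modified pyramids: for every `p ≥ 1` there is a single-sink DAG of fan-in 2 with at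
most `p²` vertices and persistent pebbling price exactly `p` (Lemma `lem:ModifiedPyramids`). -/
theorem modified_pyramids (p : ℕ) (hp : 1 ≤ p) :
    ∃ (G : Dgraph) (z : G.V),
      G.Acyclic ∧ G.UniqueSink z ∧ G.InDegLe2 ∧
      Fintype.card G.V ≤ p ^ 2 ∧ G.pers z = p := by
  obtain ⟨S, hL, h0, hc, h1, h2⟩ := PyrAux.exists_set p hp
  refine ⟨PyrAux.Gr S, PyrAux.mk h0, PyrAux.acyclic_Gr S, PyrAux.sink_Gr hL h0,
    PyrAux.indeg_Gr S, ?_, PyrAux.pers_eq h0 hp h1 h2⟩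
  have : Fintype.card (PyrAux.Gr S).V = S.card := Fintype.card_coe S
  omega
end

section
/- For every integer r ≥ 1 there exists a DAG T_r with a unique sink, in-degree at most 2, at most r³ vertices, and Visit(T_r) = Pers(T_r) = r. -/
namespace XT

/-! ### Generic facts about first and last times -/

lemma exists_last {Q : ℕ → Prop} {a x : ℕ} (h : ∃ w, a ≤ w ∧ w ≤ x ∧ Q w) :
    ∃ w, a ≤ w ∧ w ≤ x ∧ Q w ∧ ∀ t, w < t → t ≤ x → ¬ Q t := by
  classical
  obtain ⟨w, h1, h2, h3⟩ := h
  refine ⟨Nat.findGreatest Q x, ?_, Nat.findGreatest_le x, Nat.findGreatest_spec h2 h3, ?_⟩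
  · exact h1.trans (Nat.le_findGreatest h2 h3)
  · intro t h4 h5
    exact Nat.findGreatest_is_greatest h4 h5

/-- Backwards induction on an interval. -/
lemma back_ind {Q : ℕ → Prop} {a x : ℕ} (hx : Q x)
    (hs : ∀ t, a ≤ t → t < x → Q (t+1) → Q t) : ∀ t, a ≤ t → t ≤ x → Q t := by
  have key : ∀ d t, a ≤ t → t + d = x → Q t := by
    intro d
    induction d with
    | zero => intro t _ h; rw [show t = x by omega]; exact hx
    | succ d ih => intro t h1 h; exact hs t h1 (by omega) (ih (t+1) (by omega) (by omega))
  intro t h1 h2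
  exact key (x - t) t h1 (by omega)

/-! ### Reversible pebbling of a path -/

/-- One (possibly idle) step of the reversible pebble game on the path `0, 1, 2, …`. -/
def PStep (Y Y' : Finset ℕ) : Prop :=
  ∃ v, (∀ u, u + 1 = v → u ∈ Y) ∧ ∀ w, w ≠ v → (w ∈ Y ↔ w ∈ Y')

lemma PStep.symm {Y Y' : Finset ℕ} (h : PStep Y Y') : PStep Y' Y := by
  obtain ⟨v, h1, h2⟩ := h
  refine ⟨v, fun u hu => (h2 u (by omega)).1 (h1 u hu), fun w hw => (h2 w hw).symm⟩

lemma PStep.lower {Y Y' : Finset ℕ} (h : PStep Y Y') (p : ℕ) :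
    PStep (Y.filter (· ≤ p)) (Y'.filter (· ≤ p)) := by
  obtain ⟨v, h1, h2⟩ := h
  by_cases hv : v ≤ p
  · refine ⟨v, fun u hu => ?_, fun w hw => ?_⟩
    · simp only [Finset.mem_filter]; exact ⟨h1 u hu, by omega⟩
    · simp only [Finset.mem_filter]; rw [h2 w hw]
  · refine ⟨0, fun u hu => by omega, fun w _ => ?_⟩
    simp only [Finset.mem_filter]
    by_cases hwv : w = v
    · subst hwv; simp [hv]
    · rw [h2 w hwv]

/-- The part of a configuration strictly above `p`, shifted down. -/
def up (p : ℕ) (Y : Finset ℕ) : Finset ℕ := (Y.filter (p < ·)).image (· - (p+1))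

lemma mem_up {p : ℕ} {Y : Finset ℕ} {w : ℕ} : w ∈ up p Y ↔ w + (p+1) ∈ Y := by
  simp only [up, Finset.mem_image, Finset.mem_filter]
  constructor
  · rintro ⟨a, ⟨h1, h2⟩, h3⟩
    rwa [show w + (p+1) = a by omega]
  · intro h; exact ⟨_, ⟨h, by omega⟩, by omega⟩

lemma PStep.upper {Y Y' : Finset ℕ} (h : PStep Y Y') (p : ℕ) :
    PStep (up p Y) (up p Y') := by
  obtain ⟨v, h1, h2⟩ := h
  by_cases hv : p < v
  · refine ⟨v - (p+1), fun u hu => ?_, fun w hw => ?_⟩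
    · rw [mem_up]; exact h1 _ (by omega)
    · rw [mem_up, mem_up]; exact h2 _ (by omega)
  · refine ⟨0, fun u hu => by omega, fun w _ => ?_⟩
    rw [mem_up, mem_up]; exact h2 _ (by omega)

lemma card_up (p : ℕ) (Y : Finset ℕ) : (up p Y).card ≤ (Y.filter (p < ·)).card :=
  Finset.card_image_le

/-- Statement: with at most `s` pebbles one never gets beyond position `2^s - 2`. -/
def F1 (s : ℕ) : Prop :=
  ∀ (Y : ℕ → Finset ℕ) (a b : ℕ), a ≤ b → Y a = ∅ →
    (∀ t, a ≤ t → t < b → PStep (Y t) (Y (t+1))) →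
    (∀ t, a ≤ t → t ≤ b → (Y t).card ≤ s) → ∀ y ∈ Y b, y + 1 < 2 ^ s

lemma F1.rev {s : ℕ} (h : F1 s) (Y : ℕ → Finset ℕ) (a b : ℕ) (hab : a ≤ b) (hb : Y b = ∅)
    (hs : ∀ t, a ≤ t → t < b → PStep (Y t) (Y (t+1)))
    (hc : ∀ t, a ≤ t → t ≤ b → (Y t).card ≤ s) : ∀ y ∈ Y a, y + 1 < 2 ^ s := by
  have := h (fun t => Y (a + b - t)) a b hab (by simpa using hb) ?_ ?_
  · simpa using this
  · intro t h1 h2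
    have := (hs (a + b - (t+1)) (by omega) (by omega)).symm
    rwa [show a + b - (t+1) + 1 = a + b - t by omega] at this
  · intro t h1 h2; exact hc _ (by omega) (by omega)

lemma f1 (s : ℕ) : F1 s := by
  induction s with
  | zero =>
    intro Y a b hab _ _ hc y hy
    have := hc b hab le_rfl
    simp only [Nat.le_zero, Finset.card_eq_zero] at this
    simp [this] at hy
  | succ s ih =>
    intro Y a b hab ha hs hc y hy
    have hpos : 0 < 2 ^ s := by positivity
    obtain ⟨p, hp⟩ : ∃ p, p + 1 = 2 ^ s := ⟨2^s - 1, by omega⟩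
    -- the key claim
    have key : ∀ x, a ≤ x → x ≤ b → (∃ y ∈ Y x, p < y) → ∃ y ∈ Y x, y ≤ p := by
      intro x hax hxb hU
      by_contra hL
      push Not at hL
      have hfro : ∀ t, a ≤ t → t < x → p ∉ Y t → (∃ y ∈ Y (t+1), p < y) → ∃ y ∈ Y t, p < y := by
        rintro t h1 h2 h3 ⟨y, h4, h5⟩
        obtain ⟨v, h6, h7⟩ := hs t h1 (by omega)
        by_cases hyv : y = v
        · subst hyv
          have h8 := h6 (y-1) (by omega)
          refine ⟨y-1, h8, ?_⟩
          rcases Nat.lt_or_ge p (y-1) with h | h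
          · exact h
          · exact absurd (by rwa [show p = y - 1 by omega]) h3
        · exact ⟨y, (h7 y hyv).2 h4, h5⟩
      have hex : ∃ w, a ≤ w ∧ w ≤ x ∧ p ∈ Y w := by
        by_contra hno
        push Not at hno
        have := back_ind (Q := fun t => ∃ y ∈ Y t, p < y) (a := a) hU
          (fun t h1 h2 => hfro t h1 h2 (hno t h1 (by omega))) a le_rfl hax
        simp [ha] at this
      obtain ⟨w, hw1, hw2, hw3, hw4⟩ := exists_last hex
      have hwx : w < x := by
        rcases Nat.lt_or_ge w x with h | h
        · exact h
        · have : w = x := by omega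
          subst this
          have := hL p hw3
          omega
      have hup : ∀ t, w + 1 ≤ t → t ≤ x → ∃ y ∈ Y t, p < y :=
        back_ind hU (fun t h1 h2 => hfro t (by omega) h2 (hw4 t (by omega) (by omega)))
      have hupw : ∃ y ∈ Y w, p < y := by
        obtain ⟨y, h4, h5⟩ := hup (w+1) le_rfl hwx
        obtain ⟨v, h6, h7⟩ := hs w hw1 (by omega)
        have hpv : p = v := by
          by_contra hne
          exact hw4 (w+1) (by omega) hwx ((h7 p hne).1 hw3)
        exact ⟨y, (h7 y (by omega)).2 h4, h5⟩
      have hup' : ∀ t, w ≤ t → t ≤ x → ∃ y ∈ Y t, p < y := by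
        intro t h1 h2
        rcases Nat.eq_or_lt_of_le h1 with h | h
        · subst h; exact hupw
        · exact hup t h h2
      have := ih.rev (fun t => (Y t).filter (· ≤ p)) w x hw2 ?_ ?_ ?_ p
        (by simp [hw3])
      · omega
      · ext y; simp only [Finset.mem_filter, Finset.notMem_empty, iff_false, not_and, not_le]
        exact hL y
      · intro t h1 h2; exact (hs t (by omega) (by omega)).lower p
      · intro t h1 h2
        obtain ⟨y, h3, h4⟩ := hup' t h1 h2
        have h5 : ((Y t).filter (· ≤ p)).card < (Y t).card := by
          apply Finset.card_lt_card
          rw [Finset.filter_ssubset]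
          exact ⟨y, h3, by omega⟩
        have := hc t (by omega) (by omega)
        omega
    -- conclusion
    rcases Nat.lt_or_ge p y with hpy | hpy
    · have := ih (fun t => up p (Y t)) a b hab ?_ ?_ ?_ (y - (p+1)) ?_
      · rw [pow_succ]; omega
      · simp [up, ha]
      · intro t h1 h2; exact (hs t h1 h2).upper p
      · intro t h1 h2
        refine (card_up _ _).trans ?_
        by_cases hU : ∃ y ∈ Y t, p < y
        · obtain ⟨y', h3, h4⟩ := key t h1 h2 hU
          have h5 : ((Y t).filter (p < ·)).card < (Y t).card := by
            apply Finset.card_lt_card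
            rw [Finset.filter_ssubset]
            exact ⟨y', h3, by omega⟩
          have := hc t h1 h2
          omega
        · push Not at hU
          rw [Finset.filter_false_of_mem (fun y hy => by have := hU y hy; omega)]
          simp
      · rw [mem_up]; rwa [show y - (p+1) + (p+1) = y by omega]
    · rw [pow_succ]; omega

/-- With at most `s+1` pebbles a lone pebble is never beyond position `2^s - 1`. -/
lemma f2 (s : ℕ) (Y : ℕ → Finset ℕ) (a b : ℕ) (hab : a ≤ b) (ha : Y a = ∅)
    (hs : ∀ t, a ≤ t → t < b → PStep (Y t) (Y (t+1)))
    (hc : ∀ t, a ≤ t → t ≤ b → (Y t).card ≤ s + 1) (y : ℕ) (hy : Y b = {y}) : y < 2 ^ s := by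
  rcases Nat.eq_zero_or_pos y with h0 | h0
  · subst h0; positivity
  obtain ⟨w, hw1, hw2, hw3, hw4⟩ := exists_last (Q := fun t => y ∉ Y t) (a := a) (x := b)
    ⟨a, le_rfl, hab, by simp [ha]⟩
  have hwb : w < b := by
    rcases Nat.lt_or_ge w b with h | h
    · exact h
    · have : w = b := by omega
      subst this
      simp [hy] at hw3
  have hin : ∀ t, w < t → t ≤ b → y ∈ Y t := fun t h1 h2 => by
    have := hw4 t h1 h2; simpa using this
  have hm : y - 1 ∈ Y (w+1) := by
    obtain ⟨v, h6, h7⟩ := hs w hw1 hwb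
    have hpv : y = v := by
      by_contra hne
      exact hw3 ((h7 y hne).2 (hin _ (by omega) (by omega)))
    exact (h7 _ (by omega)).1 (h6 (y-1) (by omega))
  have := (f1 s).rev (fun t => (Y t).filter (· ≤ y - 1)) (w+1) b hwb ?_ ?_ ?_ (y-1)
        (by simp [hm])
  · omega
  · ext u; simp only [hy, Finset.mem_filter, Finset.mem_singleton, Finset.notMem_empty, iff_false]
    omega
  · intro t h1 h2; exact (hs t (by omega) (by omega)).lower _
  · intro t h1 h2
    have h5 : ((Y t).filter (· ≤ y-1)).card < (Y t).card := by
      apply Finset.card_lt_card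
      rw [Finset.filter_ssubset]
      exact ⟨y, hin t (by omega) h2, by omega⟩
    have := hc t (by omega) (by omega)
    omega


/-! ### Space-bounded reachability (upper bounds) -/

open Relation in
/-- `Q` is reachable from `P` by reversible moves, using space at most `s`. -/
def Reach (G : Dgraph) (s : ℕ) (P Q : Finset G.V) : Prop :=
  ReflTransGen (fun P Q => G.RevStep P Q ∧ P.card ≤ s ∧ Q.card ≤ s) P Q

lemma revStep_symm {G : Dgraph} (hG : ∀ v, ¬ G.edge v v) {P Q : Finset G.V}
    (h : G.RevStep P Q) : G.RevStep Q P := by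
  have hne : ∀ u v, G.edge u v → u ≠ v := fun u v h e => hG v (e ▸ h)
  rcases h with ⟨v, h1, h2, rfl⟩ | ⟨v, h1, h2, rfl⟩
  · refine Or.inr ⟨v, Finset.mem_insert_self _ _, fun u hu => Finset.mem_insert_of_mem (h2 u hu), ?_⟩
    rw [Finset.erase_insert h1]
  · refine Or.inl ⟨v, Finset.notMem_erase _ _,
      fun u hu => Finset.mem_erase.2 ⟨hne _ _ hu, h2 u hu⟩, ?_⟩
    rw [Finset.insert_erase h1]

lemma Reach.trans {G : Dgraph} {s : ℕ} {P Q R : Finset G.V} (h : Reach G s P Q)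
    (h' : Reach G s Q R) : Reach G s P R := Relation.ReflTransGen.trans h h'

lemma Reach.mono {G : Dgraph} {s s' : ℕ} (hs : s ≤ s') {P Q : Finset G.V} (h : Reach G s P Q) :
    Reach G s' P Q := by
  induction h with
  | refl => exact Relation.ReflTransGen.refl
  | tail _ h ih =>
    exact Relation.ReflTransGen.tail ih ⟨h.1, h.2.1.trans hs, h.2.2.trans hs⟩

lemma Reach.symm {G : Dgraph} (hG : ∀ v, ¬ G.edge v v) {s : ℕ} {P Q : Finset G.V}
    (h : Reach G s P Q) : Reach G s Q P := by
  induction h with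
  | refl => exact Relation.ReflTransGen.refl
  | tail _ h ih =>
    exact Relation.ReflTransGen.head ⟨revStep_symm hG h.1, h.2.2, h.2.1⟩ ih

lemma Reach.hold {G : Dgraph} {s f : ℕ} {P Q : Finset G.V} (h : Reach G s P Q)
    (F : Finset G.V) (hF : F.card ≤ f) : Reach G (s + f) (P ∪ F) (Q ∪ F) := by
  induction h with
  | refl => exact Relation.ReflTransGen.refl
  | @tail A B _ hAB ih =>
    obtain ⟨h1, h2, h3⟩ := hAB
    have hA : (A ∪ F).card ≤ s + f := (Finset.card_union_le _ _).trans (by omega)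
    have hB : (B ∪ F).card ≤ s + f := (Finset.card_union_le _ _).trans (by omega)
    by_cases he : A ∪ F = B ∪ F
    · rwa [← he]
    refine Relation.ReflTransGen.tail ih ⟨?_, hA, hB⟩
    rcases h1 with ⟨v, h4, h5, rfl⟩ | ⟨v, h4, h5, rfl⟩
    · by_cases hv : v ∈ F
      · exact absurd (by ext u; simp only [Finset.mem_union, Finset.mem_insert]; grind) he
      · refine Or.inl ⟨v, by simp [h4, hv], fun u hu => Finset.mem_union_left _ (h5 u hu), ?_⟩
        rw [Finset.insert_union]
    · by_cases hv : v ∈ F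
      · exact absurd (by ext u; simp only [Finset.mem_union, Finset.mem_erase]; grind) he
      · refine Or.inr ⟨v, by simp [h4], fun u hu => Finset.mem_union_left _ (h5 u hu), ?_⟩
        ext u; simp only [Finset.mem_union, Finset.mem_erase]; grind

/-- Reach a configuration from which `v` can be placed, place it, and undo everything else. -/
lemma Reach.pers {G : Dgraph} (hG : ∀ v, ¬ G.edge v v) {s : ℕ} {F Q : Finset G.V}
    (hF : F.card ≤ s) (h : Reach G s F Q) (v : G.V)
    (hv : v ∈ Q ∨ ∀ u, G.edge u v → u ∈ Q) : Reach G (s+1) F (F ∪ {v}) := by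
  have hQ : Q.card ≤ s := by
    rcases Relation.ReflTransGen.cases_tail h with h | ⟨_, _, h⟩
    · rw [h]; exact hF
    · exact h.2.2
  have h1 : Reach G (s+1) F Q := h.mono (by omega)
  have h2 : Reach G (s+1) Q (Q ∪ {v}) := by
    by_cases hvQ : v ∈ Q
    · rw [Finset.union_eq_left.2 (by simpa using hvQ)]; exact Relation.ReflTransGen.refl
    · refine Relation.ReflTransGen.single ⟨Or.inl ⟨v, hvQ, hv.resolve_left hvQ, ?_⟩, by omega, ?_⟩
      · ext u; simp
      · exact (Finset.card_union_le _ _).trans (by simpa using hQ)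
  exact (h1.trans h2).trans ((h.symm hG).hold {v} (by simp))

/-- Pebbling along a path whose side predecessors are held. -/
lemma reach_path {G : Dgraph} (hG : ∀ v, ¬ G.edge v v) (m : ℕ) :
    ∀ (f : ℕ) (F : Finset G.V) (x : ℕ → G.V) (y : ℕ), F.card ≤ f →
      (∀ u, G.edge u (x 0) → u ∈ F) →
      (∀ n < y, ∀ u, G.edge u (x (n+1)) → u ∈ F ∨ u = x n) → y + 1 < 2 ^ m →
      ∃ Q, x y ∈ Q ∧ F ⊆ Q ∧ Reach G (m + f) F Q := by
  induction m with
  | zero => intro f F x y _ _ _ h; simp at h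
  | succ m ih =>
    intro f F x y hF h0 hs hy
    by_cases hlt : y + 1 < 2 ^ m
    · obtain ⟨Q, h1, h2, h3⟩ := ih f F x y hF h0 hs hlt
      exact ⟨Q, h1, h2, h3.mono (by omega)⟩
    · have hpos : 0 < 2 ^ m := by positivity
      obtain ⟨p, hp⟩ : ∃ p, p + 1 = 2 ^ m := ⟨2^m - 1, by omega⟩
      have hper : Reach G (m + f + 1) F (F ∪ {x p}) := by
        rcases Nat.eq_zero_or_pos p with hp0 | hp0
        · subst hp0
          exact Reach.pers hG (by omega) Relation.ReflTransGen.refl _ (Or.inr h0)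
        · obtain ⟨Q, h1, h2, h3⟩ := ih f F x (p-1) hF h0 (fun n hn => hs n (by omega)) (by omega)
          refine Reach.pers hG (by omega) h3 _ (Or.inr fun u hu => ?_)
          rw [show p = p - 1 + 1 by omega] at hu
          rcases hs (p-1) (by omega) u hu with h | h
          · exact h2 h
          · rw [h]; exact h1
      rcases Nat.eq_or_lt_of_le (show p ≤ y by omega) with hpy | hpy
      · subst hpy
        exact ⟨_, by simp, Finset.subset_union_left, hper.mono (by omega)⟩
      · obtain ⟨Q, h1, h2, h3⟩ := ih (f+1) (F ∪ {x p}) (fun n => x (p + 1 + n)) (y - (p+1))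
          ((Finset.card_union_le _ _).trans (by simpa using hF))
          (fun u hu => by
            rcases hs p hpy u hu with h | h <;> simp [h])
          (fun n hn u hu => by
            rcases hs (p+1+n) (by omega) u hu with h | h <;> simp [h])
          (by rw [pow_succ] at hy; omega)
        refine ⟨Q, ?_, Finset.subset_union_left.trans h2, ?_⟩
        · simpa only [show p + 1 + (y - (p+1)) = y by omega] using h1
        · exact (hper.mono (by omega)).trans (h3.mono (by omega))

lemma Reach.exists_seq {G : Dgraph} {s : ℕ} {Q : Finset G.V} (h : Reach G s ∅ Q) :
    ∃ P τ, G.IsRevPebbling P τ ∧ P τ = Q ∧ G.space P τ ≤ s := by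
  induction h with
  | refl => exact ⟨fun _ => ∅, 0, ⟨rfl, by simp⟩, rfl, by simp [Dgraph.space]⟩
  | @tail A B _ hAB ih =>
    obtain ⟨P, τ, ⟨h0, h1⟩, h2, h3⟩ := ih
    obtain ⟨h4, h5, h6⟩ := hAB
    refine ⟨fun t => if t ≤ τ then P t else B, τ + 1, ⟨by simpa using h0, ?_⟩, by simp, ?_⟩
    · intro t ht
      rcases Nat.lt_or_ge t τ with h | h
      · simpa [show t ≤ τ by omega, show t + 1 ≤ τ by omega] using h1 t h
      · have : t = τ := by omega
        subst this
        simpa [h2] using h4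
    · simp only [Dgraph.space, Finset.sup_le_iff, Finset.mem_range] at h3 ⊢
      intro t ht
      by_cases h : t ≤ τ
      · simpa [h] using h3 t (by omega)
      · simpa [h] using h6

lemma price_eq {G : Dgraph} {z : G.V} {r : ℕ} (hup : Reach G r ∅ {z})
    (hlo : ∀ P τ, G.IsRevPebbling P τ → z ∈ P τ → ∃ t ≤ τ, r ≤ (P t).card) :
    G.visit z = r ∧ G.pers z = r := by
  obtain ⟨P, τ, h1, h2, h3⟩ := hup.exists_seq
  have hlo' : ∀ P τ, G.IsRevPebbling P τ → z ∈ P τ → r ≤ G.space P τ := by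
    intro P τ h4 h5
    obtain ⟨t, h6, h7⟩ := hlo P τ h4 h5
    exact h7.trans (Finset.le_sup (f := fun t => (P t).card) (by simp; omega))
  have hs : G.space P τ = r := le_antisymm h3 (hlo' P τ h1 (by simp [h2]))
  constructor
  · apply le_antisymm
    · exact Nat.sInf_le ⟨P, τ, h1, by simp [h2], hs⟩
    · unfold Dgraph.visit
      refine le_csInf ⟨r, P, τ, h1, by simp [h2], hs⟩ ?_
      rintro s ⟨P', τ', h4, h5, rfl⟩
      exact hlo' _ _ h4 h5
  · apply le_antisymm
    · exact Nat.sInf_le ⟨P, τ, h1, h2, hs⟩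
    · unfold Dgraph.pers
      refine le_csInf ⟨r, P, τ, h1, h2, hs⟩ ?_
      rintro s ⟨P', τ', h4, h5, rfl⟩
      exact hlo' _ _ h4 (by simp [h5])

/-! ### The graph: a pyramid whose `k` sources are replaced by paths with `L` vertices -/

/-- The Christmas tree; the vertex `(b, y)` sits in column `b` at height `y`. -/
abbrev CT (k L : ℕ) : Dgraph where
  V := Σ b : Fin k, Fin (L + b.val)
  edge := fun u v => u.2.val + 1 = v.2.val ∧
    (u.1.val = v.1.val ∨ (u.1.val + 1 = v.1.val ∧ L ≤ v.2.val))

/-- column -/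
def col {k L : ℕ} (v : (CT k L).V) : ℕ := v.1.val

/-- height -/
def ht {k L : ℕ} (v : (CT k L).V) : ℕ := v.2.val

lemma col_lt {k L : ℕ} (v : (CT k L).V) : col v < k := v.1.isLt
lemma ht_lt {k L : ℕ} (v : (CT k L).V) : ht v < L + col v := v.2.isLt

lemma vext {k L : ℕ} {u v : (CT k L).V} (h1 : col u = col v) (h2 : ht u = ht v) : u = v := by
  obtain ⟨⟨a, ha⟩, ⟨x, hx⟩⟩ := u
  obtain ⟨⟨b, hb⟩, ⟨y, hy⟩⟩ := v
  simp only [col, ht] at h1 h2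
  subst h1; subst h2; rfl

lemma edge_iff {k L : ℕ} {u v : (CT k L).V} : (CT k L).edge u v ↔ ht u + 1 = ht v ∧
    (col u = col v ∨ (col u + 1 = col v ∧ L ≤ ht v)) := Iff.rfl

lemma exists_vertex {k L b y : ℕ} (hb : b < k) (hy : y < L + b) :
    ∃ v : (CT k L).V, col v = b ∧ ht v = y := ⟨⟨⟨b, hb⟩, ⟨y, hy⟩⟩, rfl, rfl⟩

lemma ct_irrefl {k L : ℕ} (v : (CT k L).V) : ¬ (CT k L).edge v v := by
  rw [edge_iff]; omega

lemma ct_acyclic (k L : ℕ) : (CT k L).Acyclic := by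
  intro v h
  have key : ∀ w, Relation.TransGen (CT k L).edge v w → ht v < ht w := by
    intro w h
    induction h with
    | single h => rw [edge_iff] at h; omega
    | tail _ h ih => rw [edge_iff] at h; omega
  exact absurd (key v h) (lt_irrefl _)

lemma ct_indeg (k L : ℕ) : (CT k L).InDegLe2 := by
  intro v
  have h1 : Set.InjOn col {u : (CT k L).V | (CT k L).edge u v} := by
    intro u hu w hw h
    have hu2 := edge_iff.1 hu
    have hw2 := edge_iff.1 hw
    exact vext h (by omega)
  rw [← h1.ncard_image]
  have h2 : col '' {u : (CT k L).V | (CT k L).edge u v} ⊆ ({col v, col v - 1} : Set ℕ) := by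
    rintro _ ⟨u, hu, rfl⟩
    have hu2 := edge_iff.1 hu
    simp only [Set.mem_insert_iff, Set.mem_singleton_iff]
    omega
  exact (Set.ncard_le_ncard h2 (by simp)).trans ((Set.ncard_insert_le _ _).trans (by simp))

lemma ct_sink {k L : ℕ} (z : (CT k L).V) (h1 : col z + 1 = k)
    (h2 : ht z + 1 = L + col z) : (CT k L).UniqueSink z := by
  constructor
  · intro u hu
    rw [edge_iff] at hu
    have := col_lt u
    have := ht_lt u
    omega
  · intro w hw
    by_cases h3 : ht w + 1 < L + col w
    · obtain ⟨u, hu1, hu2⟩ := exists_vertex (col_lt w) h3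
      exact absurd (by rw [edge_iff]; omega) (hw u)
    · by_cases h4 : col w + 1 < k
      · have := ht_lt w
        obtain ⟨u, hu1, hu2⟩ := exists_vertex (L := L) (y := ht w + 1) h4 (by omega)
        exact absurd (by rw [edge_iff]; omega) (hw u)
      · have := ht_lt w
        have := col_lt w
        exact vext (by omega) (by omega)

lemma ct_card (k L : ℕ) : Fintype.card (CT k L).V ≤ k * (L + k - 1) := by
  have : Fintype.card (CT k L).V = ∑ b : Fin k, (L + b.val) := by
    change Fintype.card (Σ b : Fin k, Fin (L + b.val)) = _
    simp [Fintype.card_sigma]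
  rw [this]
  calc ∑ b : Fin k, (L + b.val) ≤ ∑ b : Fin k, (L + k - 1) :=
        Finset.sum_le_sum (fun b _ => by have := b.isLt; omega)
    _ = k * (L + k - 1) := by simp

/-! ### Upper bound -/

/-- Hold all side predecessors of column `b` up to height `y`. -/
lemma reach_side {k L m : ℕ} (y b : ℕ) (hb : b < k) (hy : y < L + b)
    (ih : ∀ v : (CT k L).V, ht v < y →
      ∃ Q, v ∈ Q ∧ Reach (CT k L) (m + (ht v + 1 - L)) ∅ Q) (n : ℕ) (hn : n ≤ y + 1 - L) (hy0 : L ≤ y + 1) (hL : 1 ≤ L) :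
    ∃ F : Finset (CT k L).V, F.card ≤ n ∧
      (∀ v : (CT k L).V, col v + 1 = b → ht v < y → y ≤ ht v + n → v ∈ F) ∧
      Reach (CT k L) (m + (y + 1 - L)) ∅ F := by
  induction n with
  | zero => exact ⟨∅, by simp, fun v _ h1 h2 => by omega, Relation.ReflTransGen.refl⟩
  | succ n ihn =>
    obtain ⟨F, h1, h2, h3⟩ := ihn (by omega)
    by_cases hex : ∃ v : (CT k L).V, col v + 1 = b ∧ ht v + n + 1 = y
    · obtain ⟨v, h4, h5⟩ := hex
      obtain ⟨Q, h6, h7⟩ := ih v (by omega)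
      have h8 := (Reach.pers ct_irrefl (by simp) h7 v (Or.inl h6)).hold F h1
      rw [Finset.empty_union, Finset.empty_union] at h8
      refine ⟨{v} ∪ F, (Finset.card_union_le _ _).trans (by rw [Finset.card_singleton]; omega), ?_,
        h3.trans (h8.mono (by omega))⟩
      intro w hw1 hw2 hw3
      rw [Finset.mem_union, Finset.mem_singleton]
      by_cases hh : y ≤ ht w + n
      · exact Or.inr (h2 w hw1 hw2 hh)
      · exact Or.inl (vext (by omega) (by omega))
    · refine ⟨F, by omega, ?_, h3⟩
      intro w hw1 hw2 hw3
      by_cases hh : y ≤ ht w + n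
      · exact h2 w hw1 hw2 hh
      · exact absurd ⟨w, hw1, by omega⟩ hex

lemma reach_col {k L m : ℕ} (hL : 1 ≤ L) (y b : ℕ) (hb : b < k) (hy : y < L + b)
    (ih : ∀ v : (CT k L).V, ht v < y →
      ∃ Q, v ∈ Q ∧ Reach (CT k L) (m + (ht v + 1 - L)) ∅ Q) (y' : ℕ) (hy' : y' ≤ y)
    (hm : y' + 1 < 2 ^ m) :
    ∃ Q : Finset (CT k L).V, (∀ v : (CT k L).V, col v = b → ht v = y' → v ∈ Q) ∧
      (∀ v : (CT k L).V, col v + 1 = b → L ≤ ht v + 1 → ht v < y → v ∈ Q) ∧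
      Reach (CT k L) (m + (y + 1 - L)) ∅ Q := by
  have hF : ∃ F : Finset (CT k L).V, F.card ≤ y + 1 - L ∧
      (∀ v : (CT k L).V, col v + 1 = b → L ≤ ht v + 1 → ht v < y → v ∈ F) ∧
      Reach (CT k L) (m + (y + 1 - L)) ∅ F := by
    by_cases h : L ≤ y + 1
    · obtain ⟨F, h1, h2, h3⟩ := reach_side y b hb hy ih (y + 1 - L) le_rfl h hL
      exact ⟨F, h1, fun v hv1 hv2 hv3 => h2 v hv1 hv3 (by omega), h3⟩
    · exact ⟨∅, by simp, fun v _ _ _ => by omega, Relation.ReflTransGen.refl⟩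
  obtain ⟨F, h1, h2, h3⟩ := hF
  let x : ℕ → (CT k L).V := fun n => ⟨⟨b, hb⟩, ⟨min n (L + b - 1), by
    change min n (L + b - 1) < L + b
    omega⟩⟩
  have hx1 : ∀ n, col (x n) = b := fun n => rfl
  have hx2 : ∀ n, n ≤ y → ht (x n) = n := fun n hn => by
    change min n (L + b - 1) = n
    omega
  obtain ⟨Q, h4, h5, h6⟩ := reach_path (G := CT k L) ct_irrefl m (y + 1 - L) F x y' h1
    (fun u hu => by
      rw [edge_iff, hx2 0 (by omega)] at hu; omega)
    (fun n hn u hu => by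
      rw [edge_iff, hx2 _ (by omega), hx1] at hu
      rcases hu.2 with h | h
      · right
        exact vext (by rw [h, hx1]) (by rw [hx2 _ (by omega)]; omega)
      · left
        exact h2 u (by omega) (by omega) (by omega)) hm
  refine ⟨Q, ?_, fun v hv1 hv2 hv3 => h5 (h2 v hv1 hv2 hv3), h3.trans h6⟩
  intro v hv1 hv2
  rwa [vext (u := v) (v := x y') (by rw [hv1, hx1]) (by rw [hv2, hx2 _ hy'])]

lemma reach_visit {k L m : ℕ} (hL : 1 ≤ L) (y : ℕ) : ∀ v : (CT k L).V, ht v = y → y + 1 < 2 ^ m →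
      ∃ Q, v ∈ Q ∧ Reach (CT k L) (m + (ht v + 1 - L)) ∅ Q := by
  induction y using Nat.strong_induction_on with
  | _ y ih =>
    intro v hv hm
    obtain ⟨Q, h1, _, h2⟩ := reach_col hL y (col v) (col_lt v) (hv ▸ ht_lt v)
      (fun w hw => ih (ht w) hw w rfl (by omega)) y le_rfl hm
    exact ⟨Q, h1 v rfl hv, by rwa [hv]⟩

lemma reach_sink {k L m : ℕ} (hL : 1 ≤ L) (z : (CT k L).V) (h1 : col z + 1 = k)
    (h2 : ht z + 1 = L + col z) (h3 : ht z + 1 = 2 ^ m) (h4 : 1 ≤ m) :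
    Reach (CT k L) (k + m) ∅ {z} := by
  have h5 : 2 ≤ 2 ^ m := by
    calc 2 = 2 ^ 1 := rfl
      _ ≤ 2 ^ m := Nat.pow_le_pow_right (by norm_num) h4
  obtain ⟨Q, h6, h7, h8⟩ := reach_col (m := m) hL (ht z) (col z) (col_lt z) (ht_lt z)
    (fun w hw => reach_visit hL (ht w) w rfl (by omega)) (ht z - 1) (by omega) (by omega)
  have := Reach.pers ct_irrefl (by simp) h8 z (Or.inr fun u hu => by
    rw [edge_iff] at hu
    rcases hu.2 with h | h
    · exact h6 u h (by omega)
    · exact h7 u h.1 (by omega) (by omega))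
  rw [Finset.empty_union] at this
  exact this.mono (by omega)


/-! ### Lower bound -/

lemma revStep_form {G : Dgraph} {P P' : Finset G.V} (h : G.RevStep P P') :
    ∃ v, (∀ u, G.edge u v → u ∈ P) ∧ ∀ u, u ≠ v → (u ∈ P ↔ u ∈ P') := by
  rcases h with ⟨v, _, h2, rfl⟩ | ⟨v, _, h2, rfl⟩
  · exact ⟨v, h2, fun u hu => by simp [hu]⟩
  · exact ⟨v, h2, fun u hu => by simp [hu]⟩

/-- A source-to-sink path, described by its column at each height. -/
def IsPath (k L : ℕ) (c : ℕ → ℕ) : Prop :=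
  c (L + k - 2) + 1 = k ∧
    ∀ y, y < L + k - 2 → c (y+1) = c y ∨ (c (y+1) = c y + 1 ∧ L ≤ y + 1)

lemma IsPath.mono {k L : ℕ} {c : ℕ → ℕ} (h : IsPath k L c) (x d : ℕ)
    (hd : x + d ≤ L + k - 2) : c x ≤ c (x + d) := by
  induction d with
  | zero => exact le_rfl
  | succ d ih =>
    have := ih (by omega)
    have := h.2 (x + d) (by omega)
    rw [← add_assoc]
    omega

lemma IsPath.mono' {k L : ℕ} {c : ℕ → ℕ} (h : IsPath k L c) {x y : ℕ} (hxy : x ≤ y)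
    (hd : y ≤ L + k - 2) : c x ≤ c y := by
  have := h.mono x (y - x) (by omega)
  rwa [Nat.add_sub_cancel' hxy] at this

lemma IsPath.lt {k L : ℕ} {c : ℕ → ℕ} (h : IsPath k L c) {y : ℕ}
    (hd : y ≤ L + k - 2) : c y < k := by
  have := h.mono' hd le_rfl
  have := h.1
  omega

lemma IsPath.upper {k L : ℕ} {c : ℕ → ℕ} (h : IsPath k L c) (y : ℕ)
    (hd : y ≤ L + k - 2) : c y ≤ c 0 + (y + 1 - L) := by
  induction y with
  | zero => omega
  | succ y ih =>
    have := ih (by omega)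
    have := h.2 y (by omega)
    omega

lemma IsPath.valid {k L : ℕ} {c : ℕ → ℕ} (h : IsPath k L c) (hL : 1 ≤ L) (y : ℕ)
    (hd : y ≤ L + k - 2) : y < L + c y := by
  have h1 : ∀ d, d ≤ L + k - 2 → (L + k - 2 - d) < L + c (L + k - 2 - d) := by
    intro d
    induction d with
    | zero =>
      intro _
      have := h.1
      rw [Nat.sub_zero]
      omega
    | succ d ih =>
      intro hd
      have h2 := ih (by omega)
      have h3 := h.2 (L + k - 2 - (d+1)) (by omega)
      have h4 : L + k - 2 - (d+1) + 1 = L + k - 2 - d := by omega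
      rw [h4] at h3
      omega
  have := h1 (L + k - 2 - y) (by omega)
  rwa [Nat.sub_sub_self hd] at this

lemma ht_le {k L : ℕ} (v : (CT k L).V) : ht v ≤ L + k - 2 := by
  have := ht_lt v
  have := col_lt v
  omega

/-- The lane of a vertex relative to a path. -/
def lane {k L : ℕ} (c : ℕ → ℕ) (v : (CT k L).V) : ℕ :=
  if c (ht v) = col v then c 0 else
    if c (ht v) < col v then col v else col v - (ht v + 1 - L)

lemma lane_spec {k L : ℕ} (c : ℕ → ℕ) (v : (CT k L).V) :
    (c (ht v) = col v ∧ lane c v = c 0) ∨ (c (ht v) < col v ∧ lane c v = col v) ∨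
    (col v < c (ht v) ∧ lane c v = col v - (ht v + 1 - L)) := by
  unfold lane
  split_ifs with h1 h2
  · exact Or.inl ⟨h1, rfl⟩
  · exact Or.inr (Or.inl ⟨h2, rfl⟩)
  · exact Or.inr (Or.inr ⟨by omega, rfl⟩)

lemma lane_iff {k L : ℕ} {c : ℕ → ℕ} (hc : IsPath k L c) (v : (CT k L).V) : lane c v = c 0 ↔ c (ht v) = col v := by
  have h1 := hc.mono' (Nat.zero_le _) (ht_le v)
  have h2 := hc.upper _ (ht_le v)
  have h3 := ht_lt v
  rcases lane_spec c v with h | h | h <;> omega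

lemma lane_lt {k L : ℕ} {c : ℕ → ℕ} (hc : IsPath k L c) (v : (CT k L).V) : lane c v < k := by
  have h1 := hc.lt (Nat.zero_le _)
  have h3 := col_lt v
  rcases lane_spec c v with h | h | h <;> omega

lemma lane_inj {k L : ℕ} {c : ℕ → ℕ} (hc : IsPath k L c) (u v : (CT k L).V) (h1 : lane c u = lane c v) (h2 : ht u = ht v) : u = v := by
  refine vext ?_ h2
  have a1 := hc.mono' (Nat.zero_le _) (ht_le v)
  have a2 := hc.upper _ (ht_le v)
  have a3 := ht_lt v
  have a4 := ht_lt u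
  have a5 := lane_spec c v
  have a6 := lane_spec c u
  rw [h2] at a6 a4
  omega

lemma lane_pred {k L : ℕ} {c : ℕ → ℕ} (hc : IsPath k L c) (hL : 1 ≤ L)
    (v : (CT k L).V) (hv : 1 ≤ ht v) :
    ∃ u, (CT k L).edge u v ∧ lane c u = lane c v ∧ ht u + 1 = ht v := by
  have a1 := hc.mono' (Nat.zero_le _) (ht_le v)
  have a2 := hc.upper _ (ht_le v)
  have a3 := ht_lt v
  have a4 := col_lt v
  have a5 := ht_le v
  have a6 := hc.2 (ht v - 1) (by omega)
  rw [Nat.sub_add_cancel hv] at a6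
  rcases lane_spec c v with h | h | h
  · have a7 := hc.valid hL (ht v - 1) (by omega)
    obtain ⟨u, h1, h2⟩ := exists_vertex (k := k) (hc.lt (y := ht v - 1) (by omega)) a7
    refine ⟨u, ?_, ?_, by omega⟩
    · rw [edge_iff]; omega
    · rw [h.2, lane_iff hc, h2, h1]
  · obtain ⟨u, h1, h2⟩ := exists_vertex (k := k) (L := L) (b := col v) (y := ht v - 1) a4 (by omega)
    refine ⟨u, ?_, ?_, by omega⟩
    · rw [edge_iff]; omega
    · have := lane_spec c u
      rw [h2, h1] at this
      omega
  · by_cases hb : L ≤ ht v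
    · obtain ⟨u, h1, h2⟩ := exists_vertex (k := k) (L := L) (b := col v - 1) (y := ht v - 1)
        (by omega) (by omega)
      refine ⟨u, ?_, ?_, by omega⟩
      · rw [edge_iff]; omega
      · have := lane_spec c u
        rw [h2, h1] at this
        omega
    · obtain ⟨u, h1, h2⟩ := exists_vertex (k := k) (L := L) (b := col v) (y := ht v - 1)
        a4 (by omega)
      refine ⟨u, ?_, ?_, by omega⟩
      · rw [edge_iff]; omega
      · have := lane_spec c u
        rw [h2, h1] at this
        omega

lemma lane_swap {k L : ℕ} {c : ℕ → ℕ} (hc : IsPath k L c) (hL : 1 ≤ L)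
    (j : ℕ) (hj : j < k) (hji : j ≠ c 0) :
    ∃ e, L ≤ e + 1 ∧ (∃ c', IsPath k L c' ∧ ∀ v : (CT k L).V, c' (ht v) = col v →
      (lane c v = j ∧ ht v ≤ e) ∨ (lane c v = c 0 ∧ e < ht v)) ∧
      ∀ v : (CT k L).V, lane c v = c 0 → ht v = e + 1 →
        ∃ u, (CT k L).edge u v ∧ lane c u = j ∧ ht u = e := by
  rcases lt_or_gt_of_ne hji with hlt | hgt
  · have hex : ∃ y, y ≤ L + k - 2 ∧ c y ≤ j + (y + 1 - L) :=
      ⟨L + k - 2, le_rfl, by have := hc.1; omega⟩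
    classical
    obtain ⟨h1, h2⟩ := Nat.find_spec hex
    have h3 : ∀ y, y < Nat.find hex → ¬ (y ≤ L + k - 2 ∧ c y ≤ j + (y + 1 - L)) :=
      fun y hy => Nat.find_min hex hy
    generalize Nat.find hex = f at h1 h2 h3
    obtain ⟨e, rfl⟩ : ∃ e, f = e + 1 := by
      rcases f with _ | e
      · omega
      · exact ⟨e, rfl⟩
    have h4 := h3 e (by omega)
    have h5 := hc.mono' (x := e) (y := e+1) (by omega) h1
    refine ⟨e, by omega, ⟨fun y => if y ≤ e then j + (y + 1 - L) else c y, ⟨?_, ?_⟩, ?_⟩, ?_⟩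
    · simp only [if_neg (show ¬ L + k - 2 ≤ e by omega)]; exact hc.1
    · intro y hy
      have h6 := hc.2 y hy
      rcases lt_trichotomy y e with hye | rfl | hye
      · simp only [if_pos (show y + 1 ≤ e by omega), if_pos hye.le]
        omega
      · simp only [if_neg (show ¬ y + 1 ≤ y by omega), if_pos le_rfl]
        omega
      · simp only [if_neg (show ¬ y + 1 ≤ e by omega), if_neg (show ¬ y ≤ e by omega)]
        exact h6
    · intro v hv
      by_cases hve : ht v ≤ e
      · left
        simp only [if_pos hve] at hv
        have h6 := h3 (ht v) (by omega)
        have h7 := ht_le v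
        have h8 := lane_spec c v
        omega
      · right
        simp only [if_neg hve] at hv
        exact ⟨(lane_iff hc v).2 hv, by omega⟩
    · intro v hv1 hv2
      rw [lane_iff hc, hv2] at hv1
      have h6 := ht_lt v
      have h7 := col_lt v
      obtain ⟨u, h8, h9⟩ := exists_vertex (k := k) (L := L) (b := col v - 1) (y := e)
        (by omega) (by omega)
      refine ⟨u, by rw [edge_iff]; omega, ?_, h9⟩
      have h10 := lane_spec c u
      rw [h8, h9] at h10
      omega
  · have hex : ∃ y, y ≤ L + k - 2 ∧ j ≤ c y :=
      ⟨L + k - 2, le_rfl, by have := hc.1; omega⟩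
    classical
    obtain ⟨h1, h2⟩ := Nat.find_spec hex
    have h3 : ∀ y, y < Nat.find hex → ¬ (y ≤ L + k - 2 ∧ j ≤ c y) :=
      fun y hy => Nat.find_min hex hy
    generalize Nat.find hex = f at h1 h2 h3
    obtain ⟨e, rfl⟩ : ∃ e, f = e + 1 := by
      rcases f with _ | e
      · omega
      · exact ⟨e, rfl⟩
    have h4 := h3 e (by omega)
    have h5 := hc.2 e (by omega)
    refine ⟨e, by omega, ⟨fun y => if y ≤ e then j else c y, ⟨?_, ?_⟩, ?_⟩, ?_⟩
    · simp only [if_neg (show ¬ L + k - 2 ≤ e by omega)]; exact hc.1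
    · intro y hy
      have h6 := hc.2 y hy
      rcases lt_trichotomy y e with hye | rfl | hye
      · simp only [if_pos (show y + 1 ≤ e by omega), if_pos hye.le]
        exact Or.inl trivial
      · simp only [if_neg (show ¬ y + 1 ≤ y by omega), if_pos le_rfl]
        omega
      · simp only [if_neg (show ¬ y + 1 ≤ e by omega), if_neg (show ¬ y ≤ e by omega)]
        exact h6
    · intro v hv
      by_cases hve : ht v ≤ e
      · left
        simp only [if_pos hve] at hv
        have h6 := h3 (ht v) (by omega)
        have h7 := ht_le v
        have h8 := lane_spec c v
        omega
      · right
        simp only [if_neg hve] at hv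
        exact ⟨(lane_iff hc v).2 hv, by omega⟩
    · intro v hv1 hv2
      rw [lane_iff hc, hv2] at hv1
      have h6 := ht_lt v
      have h7 := col_lt v
      obtain ⟨u, h8, h9⟩ := exists_vertex (k := k) (L := L) (b := col v) (y := e)
        (by omega) (by omega)
      refine ⟨u, by rw [edge_iff]; omega, ?_, h9⟩
      have h10 := lane_spec c u
      rw [h8, h9] at h10
      omega

lemma sum_two (f : ℕ → ℕ) {k S i j : ℕ} (hi : i < k) (hj : j < k) (hji : j ≠ i)
    (hS : ∑ l ∈ Finset.range k, f l ≤ S) (hf : ∀ l, l < k → l ≠ i → l ≠ j → 1 ≤ f l) :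
    f i + f j + k ≤ S + 2 := by
  have h1 := Finset.add_sum_erase (Finset.range k) f (Finset.mem_range.2 hi)
  have hj2 : j ∈ (Finset.range k).erase i := Finset.mem_erase.2 ⟨hji, Finset.mem_range.2 hj⟩
  have h2 := Finset.add_sum_erase ((Finset.range k).erase i) f hj2
  have h3 : _ ≤ ∑ x ∈ ((Finset.range k).erase i).erase j, f x :=
    Finset.card_nsmul_le_sum (((Finset.range k).erase i).erase j) f 1 (by
    intro l hl
    simp only [Finset.mem_erase, Finset.mem_range] at hl
    exact hf l hl.2.2 hl.2.1 hl.1)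
  rw [Finset.card_erase_of_mem hj2, Finset.card_erase_of_mem (Finset.mem_range.2 hi),
    Finset.card_range, smul_eq_mul] at h3
  omega

lemma sum_one (f : ℕ → ℕ) {k S i : ℕ} (hi : i < k)
    (hS : ∑ l ∈ Finset.range k, f l ≤ S) (hf : ∀ l, l < k → l ≠ i → 1 ≤ f l) :
    f i + k ≤ S + 1 := by
  have h1 := Finset.add_sum_erase (Finset.range k) f (Finset.mem_range.2 hi)
  have h3 : _ ≤ ∑ x ∈ (Finset.range k).erase i, f x :=
    Finset.card_nsmul_le_sum ((Finset.range k).erase i) f 1 (by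
    intro l hl
    simp only [Finset.mem_erase, Finset.mem_range] at hl
    exact hf l hl.2 hl.1)
  rw [Finset.card_erase_of_mem (Finset.mem_range.2 hi),
    Finset.card_range, smul_eq_mul] at h3
  omega

/-- Heights of the pebbles in lane `j`. -/
def Ys {k L : ℕ} (c : ℕ → ℕ) (j : ℕ) (S : Finset (CT k L).V) : Finset ℕ :=
  (S.filter (fun v => lane c v = j)).image ht

lemma mem_Ys {k L : ℕ} {c : ℕ → ℕ} {j : ℕ} {S : Finset (CT k L).V} {y : ℕ} :
    y ∈ Ys c j S ↔ ∃ v ∈ S, lane c v = j ∧ ht v = y := by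
  simp only [Ys, Finset.mem_image, Finset.mem_filter, and_assoc]

lemma sum_Ys {k L : ℕ} {c : ℕ → ℕ} (hc : IsPath k L c) (S : Finset (CT k L).V) :
    ∑ j ∈ Finset.range k, (Ys c j S).card = S.card := by
  rw [Finset.card_eq_sum_card_fiberwise (f := lane c) (t := Finset.range k)
    (fun v _ => by simpa using lane_lt hc v)]
  refine Finset.sum_congr rfl fun j _ => ?_
  refine Finset.card_image_of_injOn ?_
  intro u hu v hv h
  have hu2 := (Finset.mem_filter.1 hu).2
  have hv2 := (Finset.mem_filter.1 hv).2
  exact lane_inj hc u v (hu2.trans hv2.symm) h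

lemma Ys_step {k L : ℕ} {c : ℕ → ℕ} (hc : IsPath k L c) (hL : 1 ≤ L) (j : ℕ)
    {S S' : Finset (CT k L).V} (h : (CT k L).RevStep S S') :
    PStep (Ys c j S) (Ys c j S') := by
  obtain ⟨v, h1, h2⟩ := revStep_form h
  by_cases hv : lane c v = j
  · refine ⟨ht v, ?_, ?_⟩
    · intro u hu
      obtain ⟨x, hx1, hx2, hx3⟩ := lane_pred hc hL v (by omega)
      exact mem_Ys.2 ⟨x, h1 x hx1, hx2.trans hv, by omega⟩
    · intro w hw
      rw [mem_Ys, mem_Ys]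
      constructor
      · rintro ⟨x, hx1, hx2, hx3⟩
        exact ⟨x, (h2 x (by rintro rfl; exact hw hx3.symm)).1 hx1, hx2, hx3⟩
      · rintro ⟨x, hx1, hx2, hx3⟩
        exact ⟨x, (h2 x (by rintro rfl; exact hw hx3.symm)).2 hx1, hx2, hx3⟩
  · refine ⟨0, fun u hu => by omega, ?_⟩
    intro w hw
    rw [mem_Ys, mem_Ys]
    constructor
    · rintro ⟨x, hx1, hx2, hx3⟩
      exact ⟨x, (h2 x (by rintro rfl; exact hv hx2)).1 hx1, hx2, hx3⟩
    · rintro ⟨x, hx1, hx2, hx3⟩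
      exact ⟨x, (h2 x (by rintro rfl; exact hv hx2)).2 hx1, hx2, hx3⟩

/-- A configuration is open if some source-to-sink path carries no pebble. -/
def Opn {k L : ℕ} (S : Finset (CT k L).V) : Prop :=
  ∃ c, IsPath k L c ∧ ∀ v ∈ S, c (ht v) ≠ col v

lemma lower {k L n : ℕ} (hk : 1 ≤ k) (hL : 2 ^ n ≤ L) (hLk : L + k = 2 ^ (n+1) + 1)
    (z : (CT k L).V) (hz1 : col z + 1 = k) (hz2 : ht z + 1 = L + col z)
    (P : ℕ → Finset (CT k L).V) (τ : ℕ) (hP : (CT k L).IsRevPebbling P τ) (hz : z ∈ P τ) :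
    ∃ t ≤ τ, k + (n + 1) ≤ (P t).card := by
  by_contra hcon
  push Not at hcon
  have hL1 : 1 ≤ L := Nat.one_le_two_pow.trans hL
  obtain ⟨hP0, hPs⟩ := hP
  have hzH : ht z = L + k - 2 := by omega
  -- the last open time
  have hopen0 : Opn (P 0) := by
    refine ⟨fun _ => k - 1, ⟨Nat.sub_add_cancel hk, fun _ _ => Or.inl rfl⟩, ?_⟩
    rw [hP0]; simp
  obtain ⟨t, _, htτ, ⟨c, hc, hct⟩, hlast⟩ :=
    exists_last (Q := fun t => Opn (P t)) (a := 0) (x := τ) ⟨0, le_rfl, Nat.zero_le _, hopen0⟩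
  have htne : t ≠ τ := by
    rintro rfl
    have := hct z hz
    have := hc.1
    rw [hzH] at *
    omega
  have hi : c 0 < k := hc.lt (Nat.zero_le _)
  have hsum : ∀ u, u ≤ τ → ∑ j ∈ Finset.range k, (Ys c j (P u)).card ≤ k + n := by
    intro u hu
    rw [sum_Ys hc]
    have := hcon u hu
    omega
  have hst : ∀ j u, u < τ → PStep (Ys c j (P u)) (Ys c j (P (u+1))) :=
    fun j u hu => Ys_step hc hL1 j (hPs u hu)
  have hit : Ys c (c 0) (P t) = ∅ := by
    rw [Finset.eq_empty_iff_forall_notMem]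
    intro y hy
    obtain ⟨v, h1, h2, _⟩ := mem_Ys.1 hy
    exact hct v h1 ((lane_iff hc v).1 h2)
  have hine : ∀ u, t < u → u ≤ τ → (Ys c (c 0) (P u)).Nonempty := by
    intro u h1 h2
    by_contra h3
    rw [Finset.not_nonempty_iff_eq_empty] at h3
    refine hlast u h1 h2 ⟨c, hc, fun v hv h4 => ?_⟩
    have h5 : ht v ∈ Ys c (c 0) (P u) := mem_Ys.2 ⟨v, hv, (lane_iff hc v).2 h4, rfl⟩
    rw [h3] at h5
    simp at h5
  -- the bottom vertex is toggled at time `t`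
  have hbot : ∀ v ∈ P (t+1), lane c v = c 0 → ht v = 0 := by
    intro v hv hl
    obtain ⟨x, h1, h2⟩ := revStep_form (hPs t (by omega))
    have hvt : v ∉ P t := fun h => hct v h ((lane_iff hc v).1 hl)
    have hvx : v = x := by
      by_contra hne
      exact hvt ((h2 v hne).2 hv)
    by_contra h0
    obtain ⟨u, h3, h4, _⟩ := lane_pred hc hL1 v (by omega)
    exact hct u (h1 u (hvx ▸ h3)) ((lane_iff hc u).1 (h4.trans hl))
  -- all other lanes stay occupied
  have hne : ∀ u, t ≤ u → u ≤ τ → ∀ j, j < k → j ≠ c 0 → (Ys c j (P u)).Nonempty := by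
    intro u
    induction u using Nat.strong_induction_on with
    | _ u ih =>
      intro htu huτ j hj hji
      by_contra hemp
      rw [Finset.not_nonempty_iff_eq_empty] at hemp
      obtain ⟨e, he, ⟨c', hc', hc'2⟩, hpre⟩ := lane_swap hc hL1 j hj hji
      have hblk : ∀ u', t < u' → u' ≤ τ → Ys c j (P u') = ∅ →
          ∃ y ∈ Ys c (c 0) (P u'), e < y := by
        intro u' h1 h2 h3
        by_contra h4
        push Not at h4
        refine hlast u' h1 h2 ⟨c', hc', fun v hv h5 => ?_⟩
        rcases hc'2 v h5 with ⟨h6, _⟩ | ⟨h6, h7⟩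
        · have h8 : ht v ∈ Ys c j (P u') := mem_Ys.2 ⟨v, hv, h6, rfl⟩
          rw [h3] at h8
          simp at h8
        · exact absurd (h4 _ (mem_Ys.2 ⟨v, hv, h6, rfl⟩)) (by omega)
      have hback : ∀ s, s < τ → e ∉ Ys c j (P s) → (∃ y ∈ Ys c (c 0) (P (s+1)), e < y) →
          ∃ y ∈ Ys c (c 0) (P s), e < y := by
        rintro s hs he2 ⟨y, hy, hey⟩
        obtain ⟨v, hv1, hv2, hv3⟩ := mem_Ys.1 hy
        obtain ⟨x, h1, h2⟩ := revStep_form (hPs s hs)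
        by_cases hvx : v = x
        · subst hvx
          obtain ⟨w, h3, h4, h5⟩ := lane_pred hc hL1 v (by omega)
          refine ⟨ht w, mem_Ys.2 ⟨w, h1 w h3, h4.trans hv2, rfl⟩, ?_⟩
          by_contra h6
          obtain ⟨q, hq1, hq2, hq3⟩ := hpre v hv2 (by omega)
          exact he2 (mem_Ys.2 ⟨q, h1 q hq1, hq2, hq3⟩)
        · exact ⟨y, mem_Ys.2 ⟨v, (h2 v hvx).2 hv1, hv2, hv3⟩, hey⟩
      have htu2 : t < u := by
        rcases Nat.lt_or_ge t u with h | h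
        · exact h
        · exfalso
          obtain rfl : t = u := by omega
          -- the toggled vertex at time `t` lies in lane `c 0` at height `0`
          obtain ⟨y0, hy0⟩ := hine (t+1) (by omega) (by omega)
          obtain ⟨v, hv1, hv2, hv3⟩ := mem_Ys.1 hy0
          obtain ⟨x, h1, h2⟩ := revStep_form (hPs t (by omega))
          have hvt : v ∉ P t := fun h => hct v h ((lane_iff hc v).1 hv2)
          have hvx : v = x := by
            by_contra hne
            exact hvt ((h2 v hne).2 hv1)
          have h3 : Ys c j (P (t+1)) = ∅ := by
            rw [Finset.eq_empty_iff_forall_notMem]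
            intro y hy
            obtain ⟨w, hw1, hw2, _⟩ := mem_Ys.1 hy
            have hwv : w ≠ x := by
              rintro rfl
              rw [← hvx, hv2] at hw2
              exact hji hw2.symm
            have h4 : ht w ∈ Ys c j (P t) := mem_Ys.2 ⟨w, (h2 w hwv).2 hw1, hw2, rfl⟩
            rw [hemp] at h4
            simp at h4
          obtain ⟨y, hy, hey⟩ := hblk (t+1) (by omega) (by omega) h3
          obtain ⟨w, hw1, hw2, hw3⟩ := mem_Ys.1 hy
          have := hbot w hw1 hw2
          omega
      have hUu := hblk u htu2 huτ hemp
      have hexw : ∃ w, t ≤ w ∧ w ≤ u ∧ e ∈ Ys c j (P w) := by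
        by_contra hno
        push Not at hno
        obtain ⟨y, hy, _⟩ := back_ind (Q := fun s => ∃ y ∈ Ys c (c 0) (P s), e < y) (a := t) hUu
          (fun s h1 h2 h3 => hback s (by omega) (hno s h1 h2.le) h3) t le_rfl htu
        rw [hit] at hy
        simp at hy
      obtain ⟨w, htw, hwu, hew, hwlast⟩ := exists_last hexw
      have hwu2 : w < u := by
        rcases Nat.lt_or_ge w u with h | h
        · exact h
        · obtain rfl : w = u := by omega
          rw [hemp] at hew
          simp at hew
      have hU1 := back_ind (Q := fun s => ∃ y ∈ Ys c (c 0) (P s), e < y) (a := w+1) hUu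
        (fun s h1 h2 h3 => hback s (by omega) (hwlast s (by omega) h2.le) h3)
      have hUw : ∃ y ∈ Ys c (c 0) (P w), e < y := by
        obtain ⟨y, hy, hey⟩ := hU1 (w+1) le_rfl (by omega)
        obtain ⟨v, hv1, hv2, hv3⟩ := mem_Ys.1 hy
        obtain ⟨q, hq1, hq2, hq3⟩ := mem_Ys.1 hew
        obtain ⟨x, h1, h2⟩ := revStep_form (hPs w (by omega))
        have hqx : q = x := by
          by_contra hne
          exact hwlast (w+1) (by omega) (by omega) (mem_Ys.2 ⟨q, (h2 q hne).1 hq1, hq2, hq3⟩)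
        have hvx : v ≠ x := by
          rintro rfl
          rw [hqx, hv2] at hq2
          exact hji hq2.symm
        exact ⟨y, mem_Ys.2 ⟨v, (h2 v hvx).2 hv1, hv2, hv3⟩, hey⟩
      have hU : ∀ s, w ≤ s → s ≤ u → ∃ y ∈ Ys c (c 0) (P s), e < y := by
        intro s h1 h2
        rcases Nat.lt_or_ge w s with h | h
        · exact hU1 s h h2
        · obtain rfl : w = s := by omega
          exact hUw
      by_cases hsmall : ∀ s, w ≤ s → s ≤ u → (Ys c j (P s)).card ≤ n
      · have := (f1 n).rev (fun s => Ys c j (P s)) w u hwu hemp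
          (fun s _ h2 => hst j s (by omega)) hsmall e hew
        omega
      · push Not at hsmall
        obtain ⟨x, hwx, hxu, hxn⟩ := hsmall
        have hxu2 : x < u := by
          rcases Nat.lt_or_ge x u with h | h
          · exact h
          · obtain rfl : x = u := by omega
            rw [hemp] at hxn
            simp at hxn
        have h2 := sum_two (fun l => (Ys c l (P x)).card) hi hj hji (hsum x (by omega))
          (fun l hl hl2 _ => Finset.card_pos.2 (ih x hxu2 (by omega) (by omega) l hl hl2))
        obtain ⟨y, hy, hey⟩ := hU x hwx hxu
        have h3 : Ys c (c 0) (P x) = {y} := by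
          have h4 : (Ys c (c 0) (P x)).card ≤ 1 := by
            have h5 : (Ys c (c 0) (P x)).card + (Ys c j (P x)).card + k ≤ k + n + 2 := h2
            omega
          refine Finset.eq_singleton_iff_unique_mem.2 ⟨hy, fun y' hy' => ?_⟩
          exact Finset.card_le_one.1 h4 _ hy' _ hy
        have h4 := f2 n (fun s => Ys c (c 0) (P s)) t x (by omega) hit
          (fun s _ h2 => hst _ s (by omega))
          (fun s h5 h6 => by
            have h7 := sum_one (fun l => (Ys c l (P s)).card) hi (hsum s (by omega))
              (fun l hl hl2 => Finset.card_pos.2 (ih s (by omega) h5 (by omega) l hl hl2))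
            change (Ys c (c 0) (P s)).card + k ≤ k + n + 1 at h7
            change (Ys c (c 0) (P s)).card ≤ n + 1
            omega) y h3
        omega
  have hfin := f1 (n+1) (fun s => Ys c (c 0) (P s)) t τ htτ hit (fun s _ h2 => hst _ s h2)
    (fun s h5 h6 => by
      have h7 := sum_one (fun l => (Ys c l (P s)).card) hi (hsum s (by omega))
        (fun l hl hl2 => Finset.card_pos.2 (hne s h5 h6 l hl hl2))
      change (Ys c (c 0) (P s)).card + k ≤ k + n + 1 at h7
      change (Ys c (c 0) (P s)).card ≤ n + 1
      omega) (ht z) (mem_Ys.2 ⟨z, hz, (lane_iff hc z).2 (by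
        have := hc.1
        rw [hzH]; omega), rfl⟩)
  omega

lemma ct_main (k L n : ℕ) (hk : 1 ≤ k) (hL : 2 ^ n ≤ L) (hLk : L + k = 2 ^ (n+1) + 1) :
    ∃ (G : Dgraph) (z : G.V), G.Acyclic ∧ G.UniqueSink z ∧ G.InDegLe2 ∧
      Fintype.card G.V ≤ k * 2 ^ (n+1) ∧ G.visit z = k + (n+1) ∧ G.pers z = k + (n+1) := by
  have hL1 : 1 ≤ L := Nat.one_le_two_pow.trans hL
  obtain ⟨z, hz1, hz2⟩ := exists_vertex (k := k) (L := L) (b := k - 1) (y := L + k - 2)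
    (by omega) (by omega)
  have h1 := price_eq (reach_sink (m := n+1) hL1 z (by omega) (by omega) (by omega) (by omega))
    (lower hk hL hLk z (by omega) (by omega))
  refine ⟨CT k L, z, ct_acyclic k L, ct_sink z (by omega) (by omega), ct_indeg k L, ?_, h1.1, h1.2⟩
  have h2 := ct_card k L
  have h3 : L + k - 1 = 2 ^ (n+1) := by omega
  rwa [h3] at h2

lemma ct_one : ∃ (G : Dgraph) (z : G.V), G.Acyclic ∧ G.UniqueSink z ∧ G.InDegLe2 ∧
      Fintype.card G.V ≤ 1 ∧ G.visit z = 1 ∧ G.pers z = 1 := by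
  obtain ⟨z, hz1, hz2⟩ := exists_vertex (k := 1) (L := 1) (b := 0) (y := 0)
    (by omega) (by omega)
  have h0 : Reach (CT 1 1) 1 ∅ {z} := by
    have := Reach.pers (G := CT 1 1) (s := 0) (F := ∅) (Q := ∅) ct_irrefl (by simp)
      Relation.ReflTransGen.refl z (Or.inr fun u hu => by rw [edge_iff] at hu; omega)
    simpa using this
  have h1 := price_eq h0 (fun P τ _ hz => ⟨τ, le_rfl, Finset.card_pos.2 ⟨z, hz⟩⟩)
  exact ⟨CT 1 1, z, ct_acyclic 1 1, ct_sink z (by omega) (by omega), ct_indeg 1 1,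
    ct_card 1 1, h1.1, h1.2⟩

end XT

/-- Christmas trees: for every `r ≥ 1` there is a single-sink DAG of fan-in 2 with at most
`r³` vertices whose visiting and persistent prices both equal `r`
(Lemma `lem:ChristmasTree`). -/
theorem christmas_tree (r : ℕ) (hr : 1 ≤ r) :
    ∃ (G : Dgraph) (z : G.V),
      G.Acyclic ∧ G.UniqueSink z ∧ G.InDegLe2 ∧
      Fintype.card G.V ≤ r ^ 3 ∧ G.visit z = r ∧ G.pers z = r := by
  rcases Nat.lt_or_ge r 2 with h | h
  · obtain rfl : r = 1 := by omega
    simpa using XT.ct_one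
  · have hex : ∃ n, r ≤ 2 ^ n + n + 2 := ⟨r, by have := Nat.zero_le (2 ^ r); omega⟩
    classical
    have h1 := Nat.find_spec hex
    have h2 : ∀ n, n < Nat.find hex → ¬ r ≤ 2 ^ n + n + 2 := fun n hn => Nat.find_min hex hn
    generalize Nat.find hex = n at h1 h2
    have h3 : ∃ k, 1 ≤ k ∧ r = k + (n+1) ∧ k ≤ 2 ^ n + 1 ∧ k * 2 ^ (n+1) ≤ r ^ 3 := by
      rcases n with _ | n
      · refine ⟨r - 1, by omega, by omega, by omega, ?_⟩
        have : r = 2 ∨ r = 3 := by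
          norm_num at h1
          omega
        rcases this with rfl | rfl <;> norm_num
      · have h4 := h2 n (by omega)
        have h5 : 1 ≤ 2 ^ n := Nat.one_le_two_pow
        obtain ⟨k, rfl⟩ : ∃ k, r = k + (n+1+1) := ⟨r - (n+1+1), by omega⟩
        refine ⟨k, by omega, rfl, by omega, ?_⟩
        have h6 : 2 ^ n ≤ k := by omega
        calc k * 2 ^ (n+1+1) = k * (4 * 2 ^ n) := by ring
          _ ≤ k * (4 * k) := by gcongr
          _ ≤ (k + 1) ^ 3 := by nlinarith [sq_nonneg ((k:ℤ) - 1), Nat.zero_le (k^3), mul_self_nonneg ((k:ℤ)-1)]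
          _ ≤ (k + (n+1+1)) ^ 3 := by gcongr; omega
    obtain ⟨k, hk, rfl, hk2, hk3⟩ := h3
    have hp : 2 ^ (n+1) = 2 * 2 ^ n := by ring
    obtain ⟨G, z, g1, g2, g3, g4, g5, g6⟩ := XT.ct_main k (2 ^ (n+1) + 1 - k) n hk (by omega) (by omega)
    exact ⟨G, z, g1, g2, g3, g4.trans hk3, g5, g6⟩
end
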